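/- Let 0 < ε₀ < 1/54. For every δ > 0 there exists a constant c_δ > 0 such that the following holds. Let p be a prime and A ⊆ F_p a finite set with |A|·|A−A|·|A²−A²| ≤ p² and |A−A| ≤ |A|^{1+ε₀}. Then |A²−A²| ≥ c_δ·p^{−δ}·|A|^{1 + (9−27ε₀)/17}. -/

import Mathlib

open Finset Pointwise

namespace FpSumProd

/-- `A² = {a² : a ∈ A}`. -/
def sqSet {p : ℕ} (A : Finset (ZMod p)) : Finset (ZMod p) := A.image fun a => a ^ 2

/-- `A² - A² = {a² - b² : a, b ∈ A}` (here `A - B` denotes the pointwise difference set). -/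
def sqDiff {p : ℕ} (A : Finset (ZMod p)) : Finset (ZMod p) := sqSet A - sqSet A

section Energy
open scoped Combinatorics.Additive

variable {G : Type*} [AddCommGroup G] [DecidableEq G]

/-- The elements of `S` whose translate by `x` remains in `S`. -/
def shiftInter (S : Finset G) (x : G) : Finset G := S.filter fun b => b + x ∈ S

lemma mem_shiftInter {S : Finset G} {x b : G} : b ∈ shiftInter S x ↔ b ∈ S ∧ b + x ∈ S :=
  mem_filter

lemma shiftInter_subset (S : Finset G) (x : G) : shiftInter S x ⊆ S := filter_subset _ _

lemma shiftInter_comm (S : Finset G) (x d : G) :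
    shiftInter (shiftInter S x) d = shiftInter (shiftInter S d) x := by
  ext b
  simp only [mem_shiftInter, add_right_comm b d x]
  tauto

lemma mem_sub_of_shiftInter_pos {S : Finset G} {x : G} (h : 0 < #(shiftInter S x)) :
    x ∈ S - S := by
  obtain ⟨b, hb⟩ := card_pos.1 h
  rw [mem_shiftInter] at hb
  simpa using sub_mem_sub hb.2 hb.1

variable [Fintype G]

/-- The additive energy of `S` and `T`, counted by the common difference. -/
def diffEnergy (S T : Finset G) : ℕ := ∑ x, #(shiftInter S x) * #(shiftInter T x)

lemma addEnergy_le_diffEnergy (S T : Finset G) : E[S, T] ≤ diffEnergy S T := by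
  unfold addEnergy diffEnergy
  rw [card_eq_sum_card_fiberwise (f := fun x => x.1.2 - x.1.1) (t := univ) (by simp)]
  refine sum_le_sum fun x _ => ?_
  rw [← card_product]
  refine card_le_card_of_injOn (fun q => (q.1.1, q.2.2)) ?_ ?_
  · rintro ⟨⟨a, a'⟩, b, b'⟩ h
    simp only [coe_filter, mem_filter, mem_product, Set.mem_ofPred_eq, coe_product,
      Set.mem_prod, mem_coe, mem_shiftInter] at h ⊢
    obtain ⟨⟨⟨⟨ha, ha'⟩, hb, hb'⟩, h⟩, rfl⟩ := h
    refine ⟨⟨ha, by simpa using ha'⟩, hb', ?_⟩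
    rwa [show b' + (a' - a) = b by rw [add_sub, sub_eq_iff_eq_add, add_comm b', ← h, add_comm]]
  · rintro ⟨⟨a, a'⟩, b, b'⟩ h ⟨⟨c, c'⟩, d, d'⟩ h' he
    simp only [coe_filter, mem_filter, mem_product, Set.mem_ofPred_eq, Prod.mk.injEq] at h h' he ⊢
    obtain ⟨rfl, rfl⟩ := he
    have h3 : a' = c' := sub_left_injective (h.2.trans h'.2.symm)
    subst h3
    refine ⟨⟨rfl, rfl⟩, ?_, rfl⟩
    exact add_left_cancel (h.1.2.trans h'.1.2.symm)

omit [Fintype G] in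
lemma card_shiftInter_neg (S : Finset G) (x : G) : #(shiftInter (-S) x) = #(shiftInter S x) := by
  refine card_nbij' (fun b => -b - x) (fun b => -b - x) ?_ ?_ ?_ ?_
  · intro b hb
    simp only [mem_coe, mem_shiftInter, mem_neg'] at hb ⊢
    refine ⟨by simpa [neg_add_eq_sub, sub_neg_eq_add, add_comm] using hb.2, by simpa using hb.1⟩
  · intro b hb
    simp only [mem_coe, mem_shiftInter, mem_neg'] at hb ⊢
    refine ⟨by simpa [add_comm] using hb.2, by simpa using hb.1⟩
  · intro b _; simp
  · intro b _; simp

lemma card_sq_mul_card_sq_le (U V : Finset G) :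
    #U ^ 2 * #V ^ 2 ≤ #(U - V) * diffEnergy U V := by
  have h := le_card_add_mul_addEnergy U (-V)
  rw [card_neg, ← sub_eq_add_neg] at h
  refine h.trans (Nat.mul_le_mul_left _ ((addEnergy_le_diffEnergy _ _).trans ?_))
  simp [diffEnergy, card_shiftInter_neg]

lemma sum_card_shiftInter_sq_le (S T : Finset G) :
    (∑ x ∈ T, #(shiftInter S x)) ^ 2 ≤ #S * diffEnergy S T := by
  refine le_trans ?_ (Nat.mul_le_mul_left _ (addEnergy_le_diffEnergy S T))
  refine le_trans (Nat.pow_le_pow_left (le_of_eq ?_) 2) (card_sq_le_card_mul_addEnergy S T S)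
  rw [card_filter, sum_product_right]
  simp only [shiftInter, card_filter]

lemma sum_card_shiftInter (S : Finset G) : ∑ x, #(shiftInter S x) = #S ^ 2 := by
  simp only [shiftInter, card_filter]
  rw [sum_comm, sq, ← smul_eq_mul, ← sum_const]
  refine sum_congr rfl fun b _ => ?_
  rw [← card_filter]
  refine card_nbij' (fun x => b + x) (fun x => x - b) ?_ ?_ ?_ ?_ <;> intro x <;> simp

lemma sum_diffEnergy_shiftInter (S : Finset G) :
    ∑ x, ∑ y, diffEnergy (shiftInter S x) (shiftInter S y) = ∑ d, #(shiftInter S d) ^ 4 := by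
  simp only [diffEnergy]
  calc _ = ∑ x, ∑ d, ∑ y, #(shiftInter (shiftInter S x) d) * #(shiftInter (shiftInter S y) d) :=
        sum_congr rfl fun x _ => sum_comm
    _ = ∑ d, ∑ x, ∑ y, #(shiftInter (shiftInter S x) d) * #(shiftInter (shiftInter S y) d) :=
        sum_comm
    _ = _ := by
        refine sum_congr rfl fun d _ => ?_
        rw [← sum_mul_sum]
        simp only [shiftInter_comm S _ d, sum_card_shiftInter]
        ring

lemma sum_mul_card_sub_le (S : Finset G) :
    ∑ x, #(shiftInter S x) * #(shiftInter S x - S) ≤ diffEnergy S (S - S) := by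
  refine sum_le_sum fun x _ => Nat.mul_le_mul_left _ (card_le_card fun u hu => ?_)
  obtain ⟨b, hb, c, hc, rfl⟩ := mem_sub.1 hu
  rw [mem_shiftInter] at hb ⊢
  exact ⟨sub_mem_sub hb.1 hc, by rw [sub_add_eq_add_sub]; exact sub_mem_sub hb.2 hc⟩

lemma sum_mul_card_sub_shiftInter_le (S : Finset G) (x : G) :
    ∑ y, #(shiftInter S y) * #(shiftInter S x - shiftInter S y) ≤
      diffEnergy S (shiftInter S x - S) := by
  refine sum_le_sum fun y _ => Nat.mul_le_mul_left _ ?_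
  refine card_le_card_of_injOn (fun u => u - y) ?_ (sub_left_injective.injOn)
  intro u hu
  obtain ⟨b, hb, c, hc, rfl⟩ := mem_sub.1 (mem_coe.1 hu)
  simp only [mem_coe, mem_shiftInter, sub_add_cancel] at hb hc ⊢
  refine ⟨?_, sub_mem_sub (mem_shiftInter.2 hb) hc.1⟩
  rw [sub_sub]
  exact sub_mem_sub (mem_shiftInter.2 hb) hc.2

end Energy

section EnergyGrowth

variable {G : Type*} [AddCommGroup G] [DecidableEq G] [Fintype G] {S : Finset G} {κ : ℝ}

lemma card_mul_pow_four_le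
    (H : ∀ T : Finset G, #T ≤ #(S - S) → (diffEnergy S T : ℝ) ≤ κ * (#T * √(#T)))
    {m : ℕ} (hm : 0 < m) {T : Finset G} (hT : ∀ x ∈ T, m ≤ #(shiftInter S x)) :
    (#T : ℝ) * m ^ 4 ≤ #S ^ 2 * κ ^ 2 := by
  have hTS : #T ≤ #(S - S) :=
    card_le_card fun x hx => mem_sub_of_shiftInter_pos (hm.trans_le (hT x hx))
  have h1 : #T * m ≤ ∑ x ∈ T, #(shiftInter S x) := by
    rw [← smul_eq_mul]; exact card_nsmul_le_sum _ _ _ hT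
  have h2 : ((#T : ℝ) * m) ^ 2 ≤ #S * (κ * (#T * √(#T))) := by
    refine le_trans ?_ (mul_le_mul_of_nonneg_left (H T hTS) (Nat.cast_nonneg _))
    exact_mod_cast (Nat.pow_le_pow_left h1 2).trans (sum_card_shiftInter_sq_le S T)
  obtain ⟨t, ht0, htt, hts⟩ : ∃ t : ℝ, 0 ≤ t ∧ (#T : ℝ) = t ^ 2 ∧ √(#T : ℝ) = t :=
    ⟨_, Real.sqrt_nonneg _, (Real.sq_sqrt (Nat.cast_nonneg _)).symm, rfl⟩
  rw [hts, htt] at h2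
  rw [htt]
  rcases ht0.eq_or_lt with h0 | h0
  · rw [← h0, zero_pow two_ne_zero, zero_mul]
    exact mul_nonneg (sq_nonneg _) (sq_nonneg _)
  have h3 : t * m ^ 2 ≤ #S * κ := by
    have : t ^ 3 * (t * m ^ 2) ≤ t ^ 3 * (#S * κ) := by nlinarith
    exact le_of_mul_le_mul_left this (by positivity)
  calc t ^ 2 * (m : ℝ) ^ 4 = (t * m ^ 2) ^ 2 := by ring
    _ ≤ (#S * κ) ^ 2 := pow_le_pow_left₀ (by positivity) h3 2
    _ = _ := by ring

lemma sum_card_shiftInter_pow_four_le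
    (H : ∀ T : Finset G, #T ≤ #(S - S) → (diffEnergy S T : ℝ) ≤ κ * (#T * √(#T))) :
    (∑ x, (#(shiftInter S x) : ℝ) ^ 4) ≤
      16 * (Nat.log 2 #S + 1 : ℕ) * (#S ^ 2 * κ ^ 2) := by
  set P := univ.filter fun x => 0 < #(shiftInter S x) with hP
  have h1 : (∑ x, (#(shiftInter S x) : ℝ) ^ 4) = ∑ x ∈ P, (#(shiftInter S x) : ℝ) ^ 4 := by
    symm
    refine sum_subset (subset_univ _) fun x _ hx => ?_
    have : #(shiftInter S x) = 0 := by simpa [hP] using hx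
    simp [this]
  rw [h1, ← sum_fiberwise_of_maps_to (s := P) (t := range (Nat.log 2 #S + 1))
    (g := fun x => Nat.log 2 #(shiftInter S x))
    (fun x _ => by
      rw [mem_range, Nat.lt_succ_iff]
      exact Nat.log_mono_right (card_le_card (shiftInter_subset _ _)))]
  calc _ ≤ ∑ j ∈ range (Nat.log 2 #S + 1), 16 * ((#S : ℝ) ^ 2 * κ ^ 2) := by
        refine sum_le_sum fun j _ => ?_
        have h2 := card_mul_pow_four_le (m := 2 ^ j) H (by positivity)
          (T := P.filter fun x => Nat.log 2 #(shiftInter S x) = j) (by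
            intro x hx
            simp only [hP, mem_filter, mem_univ, true_and] at hx
            rw [← hx.2]
            exact Nat.pow_log_le_self 2 hx.1.ne')
        refine le_trans (sum_le_card_nsmul _ _ (16 * (((2 ^ j : ℕ) : ℝ) ^ 4)) ?_) ?_
        · intro x hx
          simp only [mem_filter] at hx
          have h3 : (#(shiftInter S x) : ℝ) ≤ ((2 ^ (j + 1) : ℕ) : ℝ) := by
            rw [← hx.2]
            exact_mod_cast (Nat.lt_pow_succ_log_self (by norm_num) _).le
          calc _ ≤ ((2 ^ (j + 1) : ℕ) : ℝ) ^ 4 := pow_le_pow_left₀ (by positivity) h3 4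
            _ = _ := by push_cast; ring
        · rw [nsmul_eq_mul]; linarith
    _ = _ := by rw [sum_const, card_range, nsmul_eq_mul]; ring

lemma sum_cauchy_arith {G : Type*} [Fintype G] {r c E : G → ℝ} (hr : ∀ y, 0 ≤ r y)
    (hc : ∀ y, 0 ≤ c y) (hE : ∀ y, 0 ≤ E y) {κ Δ n w a ρ : ℝ} (hκ : 0 ≤ κ) (hΔ : 0 ≤ Δ)
    {P : Finset G} (hP : ∀ y ∈ P, Δ ≤ r y) (hPsum : n ^ 2 / 2 ≤ ∑ x ∈ P, r x)
    (hw0 : 0 ≤ w) (hxΔ : Δ ≤ ρ) (hxa : a ≤ w ^ 2)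
    (h0 : ∑ y, r y * c y ≤ κ * (a * √a)) (h3 : ∀ y, ρ ^ 2 * r y ^ 2 ≤ c y * E y) :
    ρ * (Δ ^ 2 * (n ^ 4 / 4)) ≤ κ * w ^ 3 * ∑ y, E y := by
  have hρ : 0 ≤ ρ := hΔ.trans hxΔ
  have h1 : ∑ y, r y * c y ≤ κ * w ^ 3 := by
    calc _ ≤ κ * (a * √a) := h0
      _ ≤ κ * (w ^ 2 * √(w ^ 2)) := by gcongr
      _ = κ * w ^ 3 := by rw [Real.sqrt_sq hw0]; ring
  have h2 : (∑ y ∈ P, ρ * √Δ * r y) ^ 2 ≤ (∑ y ∈ P, r y * c y) * ∑ y ∈ P, E y := by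
    refine sum_sq_le_sum_mul_sum_of_sq_le_mul _ (fun y _ => mul_nonneg (hr y) (hc y))
      (fun y _ => hE y) fun y hy => ?_
    calc (ρ * √Δ * r y) ^ 2 = Δ * (ρ ^ 2 * r y ^ 2) := by
          rw [mul_pow, mul_pow, Real.sq_sqrt hΔ]; ring
      _ ≤ r y * (c y * E y) := mul_le_mul (hP y hy) (h3 y) (by positivity) (hr y)
      _ = _ := by ring
  have hE0 : 0 ≤ ∑ y, E y := sum_nonneg fun y _ => hE y
  have h4 : (ρ * √Δ * (n ^ 2 / 2)) ^ 2 ≤ κ * w ^ 3 * ∑ y, E y := by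
    calc _ ≤ (∑ y ∈ P, ρ * √Δ * r y) ^ 2 := by
          rw [← mul_sum]; gcongr
      _ ≤ _ := h2
      _ ≤ (∑ y, r y * c y) * ∑ y, E y :=
        mul_le_mul
          (sum_le_sum_of_subset_of_nonneg (subset_univ _) fun y _ _ => mul_nonneg (hr y) (hc y))
          (sum_le_sum_of_subset_of_nonneg (subset_univ _) fun y _ _ => hE y)
          (sum_nonneg fun y _ => hE y) (sum_nonneg fun y _ => mul_nonneg (hr y) (hc y))
      _ ≤ _ := by gcongr
  refine le_trans ?_ h4
  rw [mul_pow, mul_pow, Real.sq_sqrt hΔ]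
  have : ρ * Δ ≤ ρ * ρ := by gcongr
  calc ρ * (Δ ^ 2 * (n ^ 4 / 4)) = ρ * Δ * (Δ * n ^ 4 / 4) := by ring
    _ ≤ ρ * ρ * (Δ * n ^ 4 / 4) := by gcongr
    _ = _ := by ring

lemma energy_growth_arith {n M κ l w Q : ℝ} (hn0 : 0 < n) (hM0 : 0 < M)
    (hQ0 : 0 ≤ Q) (hw2 : w ^ 2 = 4 * (κ * (M * √M)) / n ^ 2)
    (hmain : n ^ 2 / 4 * ((n ^ 2 / (2 * M)) ^ 2 * (n ^ 4 / 4)) ≤ κ * w ^ 3 * Q)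
    (hQle : Q ≤ 16 * l * (n ^ 2 * κ ^ 2)) :
    n ^ 44 ≤ 2 ^ 52 * l ^ 4 * κ ^ 18 * M ^ 17 := by
  have e1 : (n ^ 2 / 4 * ((n ^ 2 / (2 * M)) ^ 2 * (n ^ 4 / 4))) ^ 4 ≤ (κ * w ^ 3 * Q) ^ 4 :=
    pow_le_pow_left₀ (by positivity) hmain 4
  have e2 : (κ * w ^ 3 * Q) ^ 4 = κ ^ 10 * M ^ 9 * 2 ^ 12 / n ^ 12 * Q ^ 4 := by
    have hs : √M ^ 2 = M := Real.sq_sqrt hM0.le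
    calc _ = κ ^ 4 * (w ^ 2) ^ 6 * Q ^ 4 := by ring
      _ = κ ^ 10 * M ^ 6 * (√M ^ 2) ^ 3 * 2 ^ 12 / n ^ 12 * Q ^ 4 := by
        rw [hw2]; field_simp; ring
      _ = _ := by rw [hs]; ring
  have e3 : (n ^ 2 / 4 * ((n ^ 2 / (2 * M)) ^ 2 * (n ^ 4 / 4))) ^ 4 = n ^ 40 / (2 ^ 24 * M ^ 8) := by
    field_simp; norm_num
  have e4 : Q ^ 4 ≤ (16 * l * (n ^ 2 * κ ^ 2)) ^ 4 := pow_le_pow_left₀ hQ0 hQle 4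
  have e5 : n ^ 40 / (2 ^ 24 * M ^ 8) ≤
      κ ^ 10 * M ^ 9 * 2 ^ 12 / n ^ 12 * (16 * l * (n ^ 2 * κ ^ 2)) ^ 4 := by
    rw [← e3]; refine (e1.trans_eq e2).trans ?_; gcongr
  rw [div_le_iff₀ (by positivity)] at e5
  have e6 : n ^ 12 * n ^ 40 ≤ n ^ 12 * (κ ^ 10 * M ^ 9 * 2 ^ 12 / n ^ 12 *
      (16 * l * (n ^ 2 * κ ^ 2)) ^ 4 * (2 ^ 24 * M ^ 8)) := by gcongr
  have e7 : n ^ 8 * n ^ 44 ≤ n ^ 8 * (2 ^ 52 * l ^ 4 * κ ^ 18 * M ^ 17) := by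
    calc _ = n ^ 12 * n ^ 40 := by ring
      _ ≤ _ := e6
      _ = _ := by field_simp; ring
  exact le_of_mul_le_mul_left e7 (by positivity)

/-- If all energies `E(S, T)` with `|T| ≤ |S - S|` are at most `κ |T|^{3/2}`, then `S - S` is
large in terms of `|S|` and `κ`. -/
lemma card_pow_le_of_diffEnergy_le (hS : S.Nonempty) (hκ : 0 ≤ κ)
    (H : ∀ T : Finset G, #T ≤ #(S - S) → (diffEnergy S T : ℝ) ≤ κ * (#T * √(#T))) :
    (#S : ℝ) ^ 44 ≤ 2 ^ 52 * (Nat.log 2 #S + 1 : ℕ) ^ 4 * κ ^ 18 * (#(S - S) : ℝ) ^ 17 := by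
  obtain ⟨n, hn⟩ : ∃ n : ℝ, n = #S := ⟨_, rfl⟩
  obtain ⟨M, hM⟩ : ∃ M : ℝ, M = #(S - S) := ⟨_, rfl⟩
  obtain ⟨r, hr⟩ : ∃ r : G → ℝ, ∀ x, r x = #(shiftInter S x) := ⟨_, fun _ => rfl⟩
  obtain ⟨a, ha⟩ : ∃ a : G → ℝ, ∀ x, a x = #(shiftInter S x - S) := ⟨_, fun _ => rfl⟩
  obtain ⟨Q, hQ⟩ : ∃ Q : ℝ, Q = ∑ x, (#(shiftInter S x) : ℝ) ^ 4 := ⟨_, rfl⟩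
  have hn0 : 0 < n := by simpa [hn] using hS
  have hM0 : 0 < M := by simpa [hM] using hS.sub hS
  have hr0 : ∀ x, 0 ≤ r x := fun x => hr x ▸ Nat.cast_nonneg _
  have ha0 : ∀ x, 0 ≤ a x := fun x => ha x ▸ Nat.cast_nonneg _
  have hrsum : ∑ x, r x = n ^ 2 := by
    simp only [hr, hn]; exact_mod_cast sum_card_shiftInter S
  obtain ⟨W, hW⟩ : ∃ W : ℝ, W = κ * (M * √M) := ⟨_, rfl⟩
  have hraW : ∑ x, r x * a x ≤ W := by
    rw [hW, hM]
    refine le_trans ?_ (H (S - S) le_rfl)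
    simp only [hr, ha]; exact_mod_cast sum_mul_card_sub_le S
  set Δ : ℝ := n ^ 2 / (2 * M) with hΔ
  have hΔ0 : 0 < Δ := by positivity
  set P := univ.filter fun x => Δ ≤ r x with hP
  have hPsum : n ^ 2 / 2 ≤ ∑ x ∈ P, r x := by
    have h1 : ∑ x with ¬ Δ ≤ r x, r x ≤ n ^ 2 / 2 := by
      calc ∑ x with ¬ Δ ≤ r x, r x ≤ ∑ x ∈ S - S, Δ := by
            refine le_trans (b := ∑ x ∈ (univ.filter fun x => ¬ Δ ≤ r x) ∩ (S - S), r x) ?_ ?_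
            · refine le_of_eq (sum_subset inter_subset_left fun x hx hx' => ?_).symm
              by_contra h0
              refine hx' (mem_inter.2 ⟨hx, mem_sub_of_shiftInter_pos (Nat.pos_of_ne_zero ?_)⟩)
              simpa [hr] using h0
            · refine (sum_le_sum (g := fun _ => Δ) fun x hx => ?_).trans
                (sum_le_sum_of_subset_of_nonneg inter_subset_right fun _ _ _ => hΔ0.le)
              have := (mem_filter.1 (mem_inter.1 hx).1).2
              exact (not_le.1 this).le
        _ = n ^ 2 / 2 := by
            rw [sum_const, nsmul_eq_mul, hΔ, ← hM]; field_simp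
    have h2 := sum_filter_add_sum_filter_not univ (fun x => Δ ≤ r x) r
    rw [hrsum] at h2
    linarith
  set w : ℝ := √(4 * W / n ^ 2) with hw
  have hW0 : 0 ≤ W := by rw [hW]; positivity
  have hw2 : w ^ 2 = 4 * W / n ^ 2 := Real.sq_sqrt (by positivity)
  have hw0 : 0 ≤ w := Real.sqrt_nonneg _
  set X := P.filter fun x => a x ≤ w ^ 2 with hX
  have hXsum : n ^ 2 / 4 ≤ ∑ x ∈ X, r x := by
    have h1 : ∑ x ∈ P with ¬ a x ≤ w ^ 2, r x ≤ n ^ 2 / 4 := by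
      rcases hW0.eq_or_lt with h0 | h0
      · have h5 : ∀ x, r x * a x = 0 := by
          have := (sum_eq_zero_iff_of_nonneg (s := univ) (f := fun x => r x * a x)
            (fun x _ => mul_nonneg (hr0 x) (ha0 x))).1
            (le_antisymm (hraW.trans h0.symm.le)
              (sum_nonneg fun x _ => mul_nonneg (hr0 x) (ha0 x)))
          exact fun x => this x (mem_univ _)
        rw [sum_eq_zero]
        · positivity
        · intro x hx
          have := (mem_filter.1 hx).2
          rw [hw2, ← h0] at this
          rcases mul_eq_zero.1 (h5 x) with h | h
          · exact h
          · simp [h] at this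
      have h2 : w ^ 2 * ∑ x ∈ P with ¬ a x ≤ w ^ 2, r x ≤ W := by
        refine le_trans ?_ hraW
        rw [mul_sum]
        refine (sum_le_sum (g := fun x => r x * a x) fun x hx => ?_).trans
          (sum_le_sum_of_subset_of_nonneg (subset_univ _)
            fun x _ _ => mul_nonneg (hr0 x) (ha0 x))
        have := (not_le.1 (mem_filter.1 hx).2).le
        rw [mul_comm]
        exact mul_le_mul_of_nonneg_left this (hr0 x)
      rw [hw2] at h2
      have h3 : 4 * W / n ^ 2 * (∑ x ∈ P with ¬ a x ≤ w ^ 2, r x) ≤ 4 * W / n ^ 2 * (n ^ 2 / 4) := by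
        rw [hw2]; refine h2.trans (le_of_eq ?_); field_simp
      exact le_of_mul_le_mul_left h3 (by positivity)
    have h2 := sum_filter_add_sum_filter_not P (fun x => a x ≤ w ^ 2) r
    linarith
  have hκw : 0 ≤ κ * w ^ 3 := by positivity
  have hkey : ∀ x ∈ X, r x * (Δ ^ 2 * (n ^ 4 / 4)) ≤
      κ * w ^ 3 * ∑ y, (diffEnergy (shiftInter S x) (shiftInter S y) : ℝ) := by
    intro x hx
    refine sum_cauchy_arith (c := fun y => (#(shiftInter S x - shiftInter S y) : ℝ)) hr0
      (fun y => Nat.cast_nonneg _) (fun y => Nat.cast_nonneg _) hκ hΔ0.le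
      (fun y hy => (mem_filter.1 hy).2) hPsum hw0
      (mem_filter.1 (mem_filter.1 hx).1).2 (mem_filter.1 hx).2 ?_ fun y => ?_
    · rw [ha]
      refine le_trans ?_ (H _ (card_le_card (sub_subset_sub_right (shiftInter_subset _ _))))
      simp only [hr]
      exact_mod_cast sum_mul_card_sub_shiftInter_le S x
    · simp only [hr]
      exact_mod_cast card_sq_mul_card_sq_le _ _
  have hmain : n ^ 2 / 4 * (Δ ^ 2 * (n ^ 4 / 4)) ≤ κ * w ^ 3 * Q := by
    calc _ ≤ (∑ x ∈ X, r x) * (Δ ^ 2 * (n ^ 4 / 4)) := by gcongr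
      _ ≤ ∑ x ∈ X, κ * w ^ 3 *
          ∑ y, (diffEnergy (shiftInter S x) (shiftInter S y) : ℝ) := by
        rw [sum_mul]; exact sum_le_sum hkey
      _ ≤ ∑ x, κ * w ^ 3 * ∑ y, (diffEnergy (shiftInter S x) (shiftInter S y) : ℝ) :=
        sum_le_sum_of_subset_of_nonneg (subset_univ _) fun _ _ _ =>
          mul_nonneg hκw (sum_nonneg fun _ _ => Nat.cast_nonneg _)
      _ = _ := by
        rw [← mul_sum, hQ]; congr 1; exact_mod_cast sum_diffEnergy_shiftInter S
  have hQle := sum_card_shiftInter_pow_four_le H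
  rw [← hQ, ← hn] at hQle
  have hQ0 : 0 ≤ Q := hQ ▸ sum_nonneg fun _ _ => pow_nonneg (Nat.cast_nonneg _) _
  obtain ⟨l, hl⟩ : ∃ l : ℝ, l = (Nat.log 2 #S + 1 : ℕ) := ⟨_, rfl⟩
  rw [hW] at hw2
  rw [← hn, ← hM, ← hl]
  rw [← hl] at hQle
  exact energy_growth_arith hn0 hM0 hQ0 hw2 hmain hQle

end EnergyGrowth

section Substitution
open MvPolynomial

variable {K : Type*} [Field K]

/-- The sum of the three partial degrees. -/
noncomputable def boxDeg (F : MvPolynomial (Fin 3) K) : ℕ :=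
  degreeOf 0 F + degreeOf 1 F + degreeOf 2 F

lemma degreeOf_le_boxDeg (i : Fin 3) (F : MvPolynomial (Fin 3) K) : degreeOf i F ≤ boxDeg F := by
  unfold boxDeg
  fin_cases i <;> simp <;> omega

lemma boxDeg_mul {F G : MvPolynomial (Fin 3) K} (hF : F ≠ 0) (hG : G ≠ 0) :
    boxDeg (F * G) = boxDeg F + boxDeg G := by
  simp only [boxDeg, degreeOf_mul_eq hF hG]; ring

lemma natDegree_aeval_le' {σ : Type*} [Fintype σ] {R A : Type*} [CommRing R] [CommRing A]
    [Algebra R A] (f : σ → Polynomial A) (F : MvPolynomial σ R) :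
    (aeval f F).natDegree ≤ ∑ i, degreeOf i F * (f i).natDegree := by
  rw [aeval_def, eval₂_eq']
  refine Polynomial.natDegree_sum_le_of_forall_le _ _ fun m hm => ?_
  refine Polynomial.natDegree_mul_le.trans ?_
  rw [Polynomial.algebraMap_apply, Polynomial.natDegree_C, zero_add]
  refine (Polynomial.natDegree_prod_le _ _).trans (sum_le_sum fun i _ => ?_)
  exact Polynomial.natDegree_pow_le.trans (Nat.mul_le_mul_right _ (monomial_le_degreeOf i hm))

lemma natDegree_aeval_le {σ : Type*} [Fintype σ] {R A : Type*} [CommRing R] [CommRing A]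
    [Algebra R A] (f : σ → Polynomial A)
    (hf : ∀ i, (f i).natDegree ≤ 1) (F : MvPolynomial σ R) :
    (aeval f F).natDegree ≤ ∑ i, degreeOf i F :=
  (natDegree_aeval_le' f F).trans
    (sum_le_sum fun i _ => (Nat.mul_le_mul_left _ (hf i)).trans_eq (mul_one _))

/-- Chain rule for a derivation of an algebra. -/
lemma derivation_aeval {σ A : Type*} [Fintype σ] [CommRing A] [Algebra K A]
    (D : Derivation K A A) (f : σ → A) (F : MvPolynomial σ K) :
    D (aeval f F) = ∑ i, aeval f (pderiv i F) * D (f i) := by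
  classical
  induction F using MvPolynomial.induction_on with
  | C a => simp
  | add p q hp hq => simp [hp, hq, add_mul, sum_add_distrib]
  | mul_X p j h =>
    simp only [map_mul, aeval_X, Derivation.leibniz, h, smul_eq_mul, map_add, pderiv_X,
      Pi.single_apply, add_mul, sum_add_distrib, mul_sum]
    congr 1
    · simp [Finset.sum_ite_eq]
    · refine sum_congr rfl fun i _ => by ring

lemma degreeOf_pderiv_le (i j : Fin 3) (F : MvPolynomial (Fin 3) K) :
    degreeOf i (pderiv j F) ≤ degreeOf i F := by
  rw [degreeOf_le_iff]
  intro m hm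
  rw [mem_support_iff, coeff_pderiv] at hm
  have := monomial_le_degreeOf i (mem_support_iff.2 (left_ne_zero_of_mul hm))
  simp only [Finsupp.coe_add, Pi.add_apply] at this
  omega

lemma degreeOf_pderiv_self_lt (i : Fin 3) {F : MvPolynomial (Fin 3) K} (h : 0 < degreeOf i F) :
    degreeOf i (pderiv i F) < degreeOf i F := by
  rw [degreeOf_lt_iff h]
  intro m hm
  rw [mem_support_iff, coeff_pderiv] at hm
  have := monomial_le_degreeOf i (mem_support_iff.2 (left_ne_zero_of_mul hm))
  simp only [Finsupp.coe_add, Pi.add_apply, Finsupp.single_eq_same] at this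
  omega

lemma pderiv_ne_zero {p : ℕ} [CharP K p] (i : Fin 3) {F : MvPolynomial (Fin 3) K}
    (h : 0 < degreeOf i F) (hp : degreeOf i F < p) : pderiv i F ≠ 0 := by
  classical
  obtain ⟨m, hm, hmi⟩ : ∃ m ∈ F.support, m i = degreeOf i F := by
    rw [degreeOf_eq_sup] at h ⊢
    obtain ⟨m, hm, h'⟩ := exists_mem_eq_sup F.support
      (by by_contra h0; rw [not_nonempty_iff_eq_empty] at h0; simp [h0] at h) (fun m => m i)
    exact ⟨m, hm, h'.symm⟩
  intro h0
  have h1 := coeff_pderiv (i := i) F (m - Finsupp.single i 1)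
  rw [h0, coeff_zero] at h1
  have h2 : m - Finsupp.single i 1 + Finsupp.single i 1 = m :=
    tsub_add_cancel_of_le (by simpa using (by omega : 1 ≤ m i))
  rw [h2] at h1
  rcases mul_eq_zero.1 h1.symm with h3 | h3
  · exact mem_support_iff.1 hm h3
  · simp only [Finsupp.coe_tsub, Pi.sub_apply, Finsupp.single_eq_same] at h3
    have h4 : (((m i - 1 + 1 : ℕ)) : K) = 0 := by exact_mod_cast h3
    rw [CharP.cast_eq_zero_iff K p] at h4
    have := Nat.le_of_dvd (by omega) h4
    omega

lemma X_sub_dvd_sub_aeval_update (i : Fin 3) (q F : MvPolynomial (Fin 3) K) :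
    X i - q ∣ F - aeval (Function.update X i q) F := by
  rw [← Ideal.mem_span_singleton, ← Ideal.Quotient.mk_eq_mk_iff_sub_mem]
  have : (Ideal.Quotient.mkₐ K (Ideal.span {X i - q})) =
      (Ideal.Quotient.mkₐ K (Ideal.span {X i - q})).comp (aeval (Function.update X i q)) := by
    refine algHom_ext fun j => ?_
    rcases eq_or_ne j i with rfl | hj
    · simp [Ideal.Quotient.mk_eq_mk_iff_sub_mem]
    · simp [Function.update_of_ne hj]
  exact DFunLike.congr_fun this F

end Substitution

section Lines
open MvPolynomial

variable {K : Type*} [Field K]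

/-- Restriction of a polynomial to the line `X = a`, `Z = bY + c` encoded by `ℓ = (a, b, c)`. -/
noncomputable def onLine (ℓ : K × K × K) : MvPolynomial (Fin 3) K →ₐ[K] Polynomial K :=
  aeval ![Polynomial.C ℓ.1, Polynomial.X, Polynomial.C ℓ.2.1 * Polynomial.X + Polynomial.C ℓ.2.2]

/-- Interchange of the first two variables. -/
noncomputable def swapXY : MvPolynomial (Fin 3) K ≃ₐ[K] MvPolynomial (Fin 3) K :=
  renameEquiv K (Equiv.swap 0 1)

/-- The line `X = ℓ.1`, `Z = ℓ.2.1 Y + ℓ.2.2` meets the line `Y = m.1`, `Z = m.2.1 X + m.2.2`. -/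
def Meets (ℓ m : K × K × K) : Prop := ℓ.2.1 * m.1 + ℓ.2.2 = m.2.1 * ℓ.1 + m.2.2

lemma Meets.symm {ℓ m : K × K × K} (h : Meets ℓ m) : Meets m ℓ := Eq.symm h

lemma natDegree_onLine_le (ℓ : K × K × K) (F : MvPolynomial (Fin 3) K) :
    (onLine ℓ F).natDegree ≤ boxDeg F := by
  refine (natDegree_aeval_le _ (fun i => ?_) F).trans_eq (by simp [Fin.sum_univ_three, boxDeg])
  fin_cases i
  · simp
  · simp
  · exact Polynomial.natDegree_linear_le

lemma eval_onLine (ℓ : K × K × K) (F : MvPolynomial (Fin 3) K) (t : K) :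
    (onLine ℓ F).eval t = eval ![ℓ.1, t, ℓ.2.1 * t + ℓ.2.2] F := by
  rw [onLine, aeval_def, eval₂_eq', Polynomial.eval_finsetSum, eval_eq']
  refine sum_congr rfl fun m _ => ?_
  simp [Fin.prod_univ_three]

lemma eval_onLine_swapXY (m : K × K × K) (F : MvPolynomial (Fin 3) K) (t : K) :
    (onLine m (swapXY F)).eval t = eval ![t, m.1, m.2.1 * t + m.2.2] F := by
  rw [eval_onLine, swapXY, renameEquiv_apply, eval_rename]
  congr 2
  ext i
  fin_cases i <;> simp [Equiv.swap_apply_of_ne_of_ne]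

lemma Meets.eval_eq {ℓ m : K × K × K} (h : Meets ℓ m) (F : MvPolynomial (Fin 3) K) :
    (onLine ℓ F).eval m.1 = (onLine m (swapXY F)).eval ℓ.1 := by
  rw [eval_onLine, eval_onLine_swapXY, h]

lemma swapXY_swapXY (F : MvPolynomial (Fin 3) K) : swapXY (swapXY F) = F := by
  simp [swapXY, rename_rename, ← Equiv.coe_trans]

lemma degreeOf_swapXY_two (F : MvPolynomial (Fin 3) K) :
    degreeOf 2 (swapXY F) = degreeOf 2 F := by
  have := degreeOf_rename_of_injective (p := F) (Equiv.swap (0 : Fin 3) 1).injective 2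
  rwa [Equiv.swap_apply_of_ne_of_ne (by decide) (by decide)] at this

lemma boxDeg_swapXY (F : MvPolynomial (Fin 3) K) : boxDeg (swapXY F) = boxDeg F := by
  have h0 := degreeOf_rename_of_injective (p := F) (Equiv.swap (0 : Fin 3) 1).injective 0
  have h1 := degreeOf_rename_of_injective (p := F) (Equiv.swap (0 : Fin 3) 1).injective 1
  rw [Equiv.swap_apply_left] at h0
  rw [Equiv.swap_apply_right] at h1
  rw [boxDeg, boxDeg, degreeOf_swapXY_two]
  simp only [swapXY, renameEquiv_apply, h0, h1]
  ring

lemma pderiv_two_swapXY (F : MvPolynomial (Fin 3) K) :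
    pderiv 2 (swapXY F) = swapXY (pderiv 2 F) := by
  have := pderiv_rename (Equiv.swap (0 : Fin 3) 1).injective 2 F
  rwa [Equiv.swap_apply_of_ne_of_ne (by decide) (by decide)] at this

lemma derivative_onLine (ℓ : K × K × K) (F : MvPolynomial (Fin 3) K) :
    Polynomial.derivative (onLine ℓ F) =
      onLine ℓ (pderiv 1 F) + Polynomial.C ℓ.2.1 * onLine ℓ (pderiv 2 F) := by
  have := derivation_aeval (Polynomial.derivative' (R := K))
    ![Polynomial.C ℓ.1, Polynomial.X, Polynomial.C ℓ.2.1 * Polynomial.X + Polynomial.C ℓ.2.2] F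
  simp only [Fin.sum_univ_three, Polynomial.derivative'_apply] at this
  rw [onLine, this]
  simp
  ring

/-- The numerator of the curvature of the plane sections `X = const` of the surface `F = 0`. -/
noncomputable def curv (F : MvPolynomial (Fin 3) K) : MvPolynomial (Fin 3) K :=
  pderiv 1 (pderiv 1 F) * pderiv 2 F ^ 2
    - (pderiv 1 (pderiv 2 F) + pderiv 2 (pderiv 1 F)) * pderiv 1 F * pderiv 2 F
    + pderiv 2 (pderiv 2 F) * pderiv 1 F ^ 2

lemma degreeOf_curv_le (i : Fin 3) (F : MvPolynomial (Fin 3) K) :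
    degreeOf i (curv F) ≤ 3 * degreeOf i F := by
  have h1 := fun j => degreeOf_pderiv_le i j F
  have h2 := fun j k => (degreeOf_pderiv_le i j (pderiv k F)).trans (h1 k)
  have h3 : ∀ j k l m, degreeOf i (pderiv j (pderiv k F) * pderiv l F * pderiv m F) ≤
      3 * degreeOf i F := fun j k l m => by
    have := degreeOf_mul_le i (pderiv j (pderiv k F) * pderiv l F) (pderiv m F)
    have := degreeOf_mul_le i (pderiv j (pderiv k F)) (pderiv l F)
    have := h2 j k; have := h1 l; have := h1 m
    omega
  have e : curv F = pderiv 1 (pderiv 1 F) * pderiv 2 F * pderiv 2 F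
    + C (-1) * (pderiv 1 (pderiv 2 F) * pderiv 1 F * pderiv 2 F
      + pderiv 2 (pderiv 1 F) * pderiv 1 F * pderiv 2 F)
    + pderiv 2 (pderiv 2 F) * pderiv 1 F * pderiv 1 F := by
    simp only [curv, map_neg, map_one]; ring
  rw [e]
  refine (degreeOf_add_le _ _ _).trans (max_le ((degreeOf_add_le _ _ _).trans
    (max_le (h3 _ _ _ _) ((degreeOf_C_mul_le _ _ _).trans ((degreeOf_add_le _ _ _).trans
    (max_le (h3 _ _ _ _) (h3 _ _ _ _)))))) (h3 _ _ _ _))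

lemma boxDeg_curv_le (F : MvPolynomial (Fin 3) K) : boxDeg (curv F) ≤ 3 * boxDeg F := by
  have := degreeOf_curv_le 0 F
  have := degreeOf_curv_le 1 F
  have := degreeOf_curv_le 2 F
  unfold boxDeg; omega

lemma boxDeg_pderiv_le (i : Fin 3) (F : MvPolynomial (Fin 3) K) :
    boxDeg (pderiv i F) ≤ boxDeg F := by
  have := degreeOf_pderiv_le 0 i F
  have := degreeOf_pderiv_le 1 i F
  have := degreeOf_pderiv_le 2 i F
  unfold boxDeg; omega

lemma onLine_curv {ℓ : K × K × K} {F : MvPolynomial (Fin 3) K} (h : onLine ℓ F = 0) :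
    onLine ℓ (curv F) = 0 := by
  have h1 := derivative_onLine ℓ F
  have h2 := congrArg Polynomial.derivative h1
  rw [h, Polynomial.derivative_zero] at h1
  rw [h, Polynomial.derivative_zero, Polynomial.derivative_zero, map_add, derivative_onLine,
    Polynomial.derivative_C_mul, derivative_onLine] at h2
  simp only [curv, map_add, map_sub, map_mul, map_pow]
  have h3 : onLine ℓ (pderiv 1 F) = - (Polynomial.C ℓ.2.1 * onLine ℓ (pderiv 2 F)) :=
    eq_neg_of_add_eq_zero_left h1.symm
  rw [h3]
  linear_combination (-onLine ℓ (pderiv 2 F) ^ 2) * h2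

end Lines

section Bezout
open MvPolynomial

variable {K : Type*} [Field K]

/-- The polynomials whose degree in the `i`-th variable is less than `d i`. -/
noncomputable def box (K : Type*) [Field K] (d : Fin 3 → ℕ) :
    Submodule K (MvPolynomial (Fin 3) K) :=
  restrictSupport K {m | ∀ i, m i < d i}

lemma mem_box_of_degreeOf_lt {d : Fin 3 → ℕ} {F : MvPolynomial (Fin 3) K}
    (h : ∀ i, degreeOf i F < d i) : F ∈ box K d := by
  rw [box, mem_restrictSupport_iff]
  exact fun m hm i => (monomial_le_degreeOf i hm).trans_lt (h i)

lemma degreeOf_lt_of_mem_box {d : Fin 3 → ℕ} {F : MvPolynomial (Fin 3) K} (hF : F ∈ box K d)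
    {i : Fin 3} (hi : 0 < d i) : degreeOf i F < d i := by
  rw [box, mem_restrictSupport_iff] at hF
  rw [degreeOf_lt_iff hi]
  exact fun m hm => hF hm i

lemma eq_zero_of_mem_box {d : Fin 3 → ℕ} {F : MvPolynomial (Fin 3) K} (hF : F ∈ box K d)
    {i : Fin 3} (hi : d i = 0) : F = 0 := by
  rw [box, mem_restrictSupport_iff] at hF
  rw [← support_eq_empty, eq_empty_iff_forall_notMem]
  intro m hm
  have := hF hm i
  omega

/-- The exponents of the polynomials in `box K d`. -/
noncomputable def boxEquiv (d : Fin 3 → ℕ) :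
    {m : Fin 3 →₀ ℕ | ∀ i, m i < d i} ≃ (∀ i, Fin (d i)) where
  toFun m i := ⟨m.1 i, m.2 i⟩
  invFun f := ⟨Finsupp.equivFunOnFinite.symm fun i => f i, fun i => (f i).2⟩
  left_inv m := by ext; simp
  right_inv f := by ext; simp

lemma finrank_box (d : Fin 3 → ℕ) : Module.finrank K (box K d) = d 0 * d 1 * d 2 := by
  rw [box, Module.finrank_eq_nat_card_basis (basisRestrictSupport K _),
    Nat.card_congr (boxEquiv d), Nat.card_eq_fintype_card, Fintype.card_pi]
  simp [Fin.prod_univ_three]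

instance (d : Fin 3 → ℕ) : FiniteDimensional K (box K d) :=
  haveI : Finite {m : Fin 3 →₀ ℕ | ∀ i, m i < d i} := Finite.of_equiv _ (boxEquiv d).symm
  Module.Finite.of_basis (basisRestrictSupport K _)

lemma card_le_degreeOf_two [DecidableEq K] {F : MvPolynomial (Fin 3) K} {a : K}
    (ha : ¬ X 0 - C a ∣ F) {s : Finset (K × K)} (hs : ∀ q ∈ s, onLine (a, q) F = 0) :
    #s ≤ degreeOf 2 F := by
  set f : Fin 3 → Polynomial (Polynomial K) :=
    ![Polynomial.C (Polynomial.C a), Polynomial.C Polynomial.X, Polynomial.X] with hf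
  have hne : aeval f F ≠ 0 := by
    intro h0
    set φ : Polynomial (Polynomial K) →+* MvPolynomial (Fin 3) K :=
      Polynomial.eval₂RingHom (Polynomial.eval₂RingHom C (X 1)) (X 2) with hφ
    have h1 : φ.comp (aeval f : MvPolynomial (Fin 3) K →ₐ[K] _).toRingHom =
        (aeval (Function.update X 0 (C a)) : MvPolynomial (Fin 3) K →ₐ[K] _).toRingHom := by
      refine MvPolynomial.ringHom_ext (fun r => ?_) fun i => ?_
      · simp [hφ, Polynomial.algebraMap_apply, algebraMap_eq]
      · fin_cases i <;> simp [hφ, hf]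
    have h2 := DFunLike.congr_fun h1 F
    simp only [AlgHom.toRingHom_eq_coe, RingHom.comp_apply, RingHom.coe_coe, h0, map_zero] at h2
    have h3 := X_sub_dvd_sub_aeval_update 0 (C a) F
    rw [← h2, sub_zero] at h3
    exact ha h3
  have hdeg : (aeval f F).natDegree ≤ degreeOf 2 F := by
    refine (natDegree_aeval_le' f F).trans_eq ?_
    simp [Fin.sum_univ_three, hf]
  set ρ : K × K → Polynomial K := fun q => Polynomial.C q.1 * Polynomial.X + Polynomial.C q.2
    with hρ
  have hinj : Function.Injective ρ := by
    intro q q' h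
    have h0 := congrArg (Polynomial.coeff · 0) h
    have h1 := congrArg (Polynomial.coeff · 1) h
    simp [hρ] at h0 h1
    exact Prod.ext h1 h0
  rw [← card_image_of_injective s hinj]
  refine le_trans ?_ ((Polynomial.card_roots' _).trans hdeg)
  refine le_trans (card_le_card ?_) (Multiset.toFinset_card_le _)
  intro u hu
  obtain ⟨q, hq, rfl⟩ := mem_image.1 hu
  rw [Multiset.mem_toFinset, Polynomial.mem_roots hne, Polynomial.IsRoot, ← hs q hq, onLine,
    ← Polynomial.coe_aeval_eq_eval]
  have : ((Polynomial.aeval (ρ q) : _ →ₐ[Polynomial K] Polynomial K).restrictScalars K).comp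
      (aeval f) = aeval ![Polynomial.C a, Polynomial.X,
        Polynomial.C q.1 * Polynomial.X + Polynomial.C q.2] := by
    refine algHom_ext fun i => ?_
    fin_cases i <;> simp [hf, hρ]
  exact DFunLike.congr_fun this F

lemma not_X_sub_C_dvd {F : MvPolynomial (Fin 3) K} (hF : Irreducible F)
    (h2 : 0 < degreeOf 2 F) (a : K) : ¬ X 0 - C a ∣ F := by
  rintro ⟨G, rfl⟩
  have h3 : degreeOf 2 (X 0 - C a : MvPolynomial (Fin 3) K) = 0 := by
    refine Nat.le_zero.1 ?_
    rw [sub_eq_add_neg, ← map_neg]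
    refine (degreeOf_add_le _ _ _).trans ?_
    simp [degreeOf_X_of_ne]
  rcases hF.isUnit_or_isUnit rfl with h | h
  · simpa using h.map (eval fun _ => a)
  · obtain ⟨c, hc⟩ := MvPolynomial.isUnit_iff_eq_C_of_isReduced.1 h
    rw [hc.2] at h2
    have := degreeOf_mul_le (2 : Fin 3) (X 0 - C a : MvPolynomial (Fin 3) K) (C c)
    rw [h3, degreeOf_C] at this
    omega

end Bezout

section Bezout
open MvPolynomial

variable {K : Type*} [Field K]

lemma mul_mem_box {d d' : Fin 3 → ℕ} {F α : MvPolynomial (Fin 3) K} (hα : α ∈ box K d)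
    (h : ∀ i, degreeOf i F + d i ≤ d' i) : F * α ∈ box K d' := by
  by_cases h0 : ∃ i, d i = 0
  · obtain ⟨i, hi⟩ := h0
    rw [eq_zero_of_mem_box hα hi, mul_zero]
    exact zero_mem _
  · push Not at h0
    refine mem_box_of_degreeOf_lt fun i => ?_
    have h1 := degreeOf_lt_of_mem_box hα (Nat.pos_of_ne_zero (h0 i))
    have h2 := degreeOf_mul_le i F α
    have h3 := h i
    omega

/-- The polynomials in the second variable with given coefficients. -/
noncomputable def polyY (K : Type*) [Field K] (n : ℕ) : (Fin n → K) →ₗ[K] MvPolynomial (Fin 3) K :=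
  Fintype.linearCombination K fun k : Fin n => (X 1 : MvPolynomial (Fin 3) K) ^ (k : ℕ)

lemma polyY_mem_box {n : ℕ} (v : Fin n → K) : polyY K n v ∈ box K ![1, n, 1] := by
  rw [polyY, Fintype.linearCombination_apply]
  refine sum_mem fun k _ => Submodule.smul_mem _ _ (mem_box_of_degreeOf_lt fun i => ?_)
  fin_cases i
  · simp [degreeOf_X_pow_of_ne]
  · simp
  · simp [degreeOf_X_pow_of_ne]

lemma onLine_polyY {n : ℕ} (ℓ : K × K × K) (v : Fin n → K) :
    onLine ℓ (polyY K n v) = ∑ k : Fin n, Polynomial.C (v k) * Polynomial.X ^ (k : ℕ) := by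
  rw [polyY, Fintype.linearCombination_apply, map_sum]
  refine sum_congr rfl fun k _ => ?_
  rw [map_smul, map_pow, onLine, aeval_X, Polynomial.smul_eq_C_mul]
  simp

lemma eq_zero_of_onLine_polyY_eq_zero {n : ℕ} {ℓ : K × K × K} {v : Fin n → K}
    (h : onLine ℓ (polyY K n v) = 0) : v = 0 := by
  rw [onLine_polyY] at h
  funext k
  have := congrArg (Polynomial.coeff · (k : ℕ)) h
  simpa [Polynomial.finsetSum_coeff, Polynomial.coeff_X_pow, Fin.val_inj] using this

variable [DecidableEq K]

/-- A polynomial vanishing on every line of `L` except `ℓ`. -/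
noncomputable def separator (L : Finset (K × K × K)) (ℓ : K × K × K) : MvPolynomial (Fin 3) K :=
  (∏ a ∈ (L.image Prod.fst).erase ℓ.1, (X 0 - C a)) *
    ∏ m ∈ (L.filter (·.1 = ℓ.1)).erase ℓ, (X 2 - (C m.2.1 * X 1 + C m.2.2))

lemma onLine_separator_eq_zero {L : Finset (K × K × K)} {ℓ m : K × K × K} (hm : m ∈ L)
    (hne : m ≠ ℓ) : onLine m (separator L ℓ) = 0 := by
  rw [separator, map_mul, map_prod, map_prod]
  by_cases h : m.1 = ℓ.1
  · refine mul_eq_zero_of_right _ (prod_eq_zero (mem_erase.2 ⟨hne, mem_filter.2 ⟨hm, h⟩⟩) ?_)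
    simp [onLine]
  · refine mul_eq_zero_of_left (prod_eq_zero (mem_erase.2 ⟨h, mem_image_of_mem _ hm⟩) ?_) _
    simp [onLine]

lemma onLine_separator_ne_zero (L : Finset (K × K × K)) (ℓ : K × K × K) :
    onLine ℓ (separator L ℓ) ≠ 0 := by
  rw [separator, map_mul, map_prod, map_prod]
  refine mul_ne_zero (prod_ne_zero_iff.2 fun a ha h => ?_) (prod_ne_zero_iff.2 fun m hm h => ?_)
  · refine (mem_erase.1 ha).1 ?_
    simp only [onLine, map_sub, aeval_X, algHom_C, Polynomial.algebraMap_apply,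
      Algebra.algebraMap_self, RingHom.id_apply] at h
    exact Polynomial.C_injective (sub_eq_zero.1 h).symm
  · obtain ⟨hne, hm⟩ := mem_erase.1 hm
    have h1 := (mem_filter.1 hm).2
    simp only [onLine, map_sub, map_add, map_mul, aeval_X, algHom_C,
      Polynomial.algebraMap_apply, Algebra.algebraMap_self, RingHom.id_apply] at h
    have e0 := congrArg (Polynomial.coeff · 0) h
    have e1 := congrArg (Polynomial.coeff · 1) h
    simp [sub_eq_zero] at e0 e1
    exact hne (Prod.ext h1 (Prod.ext e1.symm e0.symm))

omit [DecidableEq K] in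
lemma degreeOf_prod_le_card {ι : Type*} (s : Finset ι) (i : Fin 3)
    (f : ι → MvPolynomial (Fin 3) K) (hf : ∀ j ∈ s, degreeOf i (f j) ≤ 1) :
    degreeOf i (∏ j ∈ s, f j) ≤ #s :=
  (degreeOf_prod_le i s f).trans ((sum_le_sum hf).trans (by simp))

omit [DecidableEq K] in
lemma degreeOf_sub_le_max (i : Fin 3) (p q : MvPolynomial (Fin 3) K) :
    degreeOf i (p - q) ≤ max (degreeOf i p) (degreeOf i q) := by
  rw [sub_eq_add_neg, show -q = C (-1) * q by simp]
  exact (degreeOf_add_le _ _ _).trans (max_le_max le_rfl (degreeOf_C_mul_le _ _ _))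

omit [DecidableEq K] in
lemma degreeOf_X_sub_C_le (i : Fin 3) (a : K) :
    degreeOf i (X 0 - C a : MvPolynomial (Fin 3) K) ≤ if i = 0 then 1 else 0 := by
  refine (degreeOf_sub_le_max _ _ _).trans ?_
  rw [degreeOf_C, degreeOf_X]
  split_ifs <;> simp_all

omit [DecidableEq K] in
lemma degreeOf_X_sub_linear_le (i : Fin 3) (b c : K) :
    degreeOf i (X 2 - (C b * X 1 + C c) : MvPolynomial (Fin 3) K) ≤ if i = 0 then 0 else 1 := by
  refine (degreeOf_sub_le_max _ _ _).trans (max_le ?_ ((degreeOf_add_le _ _ _).trans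
    (max_le ((degreeOf_C_mul_le _ _ _).trans ?_) ?_)))
  · rw [degreeOf_X]; fin_cases i <;> simp
  · rw [degreeOf_X]; fin_cases i <;> simp
  · simp

lemma degreeOf_separator_lt {F : MvPolynomial (Fin 3) K} (hF : Irreducible F)
    (h2 : 0 < degreeOf 2 F) {L : Finset (K × K × K)} (hL : ∀ ℓ ∈ L, onLine ℓ F = 0)
    {ℓ : K × K × K} (hℓ : ℓ ∈ L) :
    degreeOf 0 (separator L ℓ) < #L ∧ ∀ i ≠ 0, degreeOf i (separator L ℓ) < degreeOf 2 F := by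
  constructor
  · refine (degreeOf_mul_le _ _ _).trans_lt ?_
    have h1 := degreeOf_prod_le_card ((L.image Prod.fst).erase ℓ.1) 0
      (fun a => (X 0 - C a : MvPolynomial (Fin 3) K)) fun a _ => degreeOf_X_sub_C_le 0 a
    have h3 := degreeOf_prod_le (0 : Fin 3) ((L.filter (·.1 = ℓ.1)).erase ℓ)
      fun m => (X 2 - (C m.2.1 * X 1 + C m.2.2) : MvPolynomial (Fin 3) K)
    rw [sum_eq_zero fun m _ => Nat.le_zero.1 (degreeOf_X_sub_linear_le 0 m.2.1 m.2.2)] at h3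
    have h4 := card_erase_lt_of_mem (mem_image_of_mem Prod.fst hℓ)
    have h5 := card_image_le (s := L) (f := Prod.fst)
    omega
  · intro i hi
    refine (degreeOf_mul_le _ _ _).trans_lt ?_
    have h1 := degreeOf_prod_le i ((L.image Prod.fst).erase ℓ.1)
      (fun a => (X 0 - C a : MvPolynomial (Fin 3) K))
    rw [sum_eq_zero fun a _ => Nat.le_zero.1
      ((degreeOf_X_sub_C_le i a).trans_eq (if_neg hi))] at h1
    have h3 := degreeOf_prod_le_card ((L.filter (·.1 = ℓ.1)).erase ℓ) i
      (fun m => (X 2 - (C m.2.1 * X 1 + C m.2.2) : MvPolynomial (Fin 3) K))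
      fun m _ => (degreeOf_X_sub_linear_le i m.2.1 m.2.2).trans_eq (if_neg hi)
    have h4 := card_erase_lt_of_mem (s := L.filter (·.1 = ℓ.1)) (mem_filter.2 ⟨hℓ, rfl⟩)
    have h5 := card_le_degreeOf_two (not_X_sub_C_dvd hF h2 ℓ.1)
      (s := (L.filter (·.1 = ℓ.1)).image Prod.snd) (by
        intro q hq
        obtain ⟨m, hm, rfl⟩ := mem_image.1 hq
        obtain ⟨hm, he⟩ := mem_filter.1 hm
        rw [← he]; exact hL m hm)
    rw [card_image_of_injOn] at h5
    · omega
    · intro m hm m' hm' h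
      exact Prod.ext ((mem_filter.1 hm).2.trans (mem_filter.1 hm').2.symm) h

lemma bezout_arith {D e g e3 g3 s : ℕ} (he : 0 < e) (he3 : e3 ≤ e) (hg3 : g3 ≤ g)
    (hD : D = 2 * (e + g + s))
    (h : (D - e) * (D - e) * g3 + ((D - g) * (D - g) * e3 + s * (D - e)) ≤ D * D * (e3 + g3)) :
    s ≤ 8 * e * g := by
  obtain ⟨u, hu⟩ : ∃ u, D = u + e := ⟨D - e, by omega⟩
  obtain ⟨v, hv⟩ : ∃ v, D = v + g := ⟨D - g, by omega⟩
  rw [show D - e = u by omega, show D - g = v by omega] at h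
  have h1 : D ≤ 2 * u := by omega
  have h2 : D * D * g3 ≤ u * u * g3 + 2 * D * (e * g3) := by
    have : D * D ≤ u * u + 2 * D * e := by rw [hu]; nlinarith
    nlinarith
  have h3 : D * D * e3 ≤ v * v * e3 + 2 * D * (g * e3) := by
    have : D * D ≤ v * v + 2 * D * g := by rw [hv]; nlinarith
    nlinarith
  have h4 : e * g3 ≤ e * g := Nat.mul_le_mul_left _ hg3
  have h5 : g * e3 ≤ e * g := by rw [mul_comm e]; exact Nat.mul_le_mul_left _ he3
  have h6 : s * u ≤ 2 * D * (2 * (e * g)) := by nlinarith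
  have h7 : D * s ≤ D * (8 * e * g) := by nlinarith
  exact Nat.le_of_mul_le_mul_left h7 (by omega)

/-- A Bézout-type bound for the number of lines contained in the intersection of two surfaces. -/
lemma card_lines_le {F J : MvPolynomial (Fin 3) K} (hF : Irreducible F) (h2 : 0 < degreeOf 2 F)
    (hJ : ¬ F ∣ J) {L : Finset (K × K × K)} (hFL : ∀ ℓ ∈ L, onLine ℓ F = 0)
    (hJL : ∀ ℓ ∈ L, onLine ℓ J = 0) : #L ≤ 8 * boxDeg F * boxDeg J := by
  have e0 := degreeOf_le_boxDeg 0 F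
  have e1 := degreeOf_le_boxDeg 1 F
  have e2 := degreeOf_le_boxDeg 2 F
  have g0 := degreeOf_le_boxDeg 0 J
  have g1 := degreeOf_le_boxDeg 1 J
  have g2 := degreeOf_le_boxDeg 2 J
  set e := boxDeg F
  set g := boxDeg J
  obtain ⟨D, hD⟩ : ∃ D, D = 2 * (e + g + #L) := ⟨_, rfl⟩
  refine bezout_arith (e3 := degreeOf 2 F) (g3 := degreeOf 2 J) (by omega) e2 g2 hD ?_
  set d1 : Fin 3 → ℕ := ![D - e, D - e, degreeOf 2 J]
  set d2 : Fin 3 → ℕ := ![D - g, D - g, degreeOf 2 F]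
  set d3 : Fin 3 → ℕ := ![D, D, degreeOf 2 F + degreeOf 2 J]
  let Φ : (box K d1 × box K d2 × (L → Fin (D - e) → K)) →ₗ[K] MvPolynomial (Fin 3) K :=
    ((LinearMap.mulLeft K F).comp (box K d1).subtype).coprod
      (((LinearMap.mulLeft K J).comp (box K d2).subtype).coprod
        (∑ ℓ : L, ((LinearMap.mulLeft K (separator L ℓ)).comp (polyY K (D - e))).comp
          (LinearMap.proj ℓ)))
  have hΦ : ∀ x, Φ x = F * x.1 + (J * x.2.1 +
      ∑ ℓ : L, separator L ℓ * polyY K (D - e) (x.2.2 ℓ)) := fun x => by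
    simp [Φ, LinearMap.coprod_apply, LinearMap.sum_apply]
  have hmem : ∀ x, Φ x ∈ box K d3 := by
    intro x
    rw [hΦ]
    refine add_mem (mul_mem_box x.1.2 fun i => ?_) (add_mem (mul_mem_box x.2.1.2 fun i => ?_)
      (sum_mem fun ℓ _ => mul_mem_box (polyY_mem_box _) fun i => ?_))
    · fin_cases i <;> simp [d1, d3] <;> omega
    · fin_cases i <;> simp [d2, d3] <;> omega
    · obtain ⟨s0, s1⟩ := degreeOf_separator_lt hF h2 hFL ℓ.2
      have s2 := s1 2 (by decide)
      have s1 := s1 1 (by decide)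
      fin_cases i <;> simp [d3] <;> omega
  have hinj : Function.Injective (Φ.codRestrict (box K d3) hmem) := by
    rw [← LinearMap.ker_eq_bot, LinearMap.ker_codRestrict, LinearMap.ker_eq_bot']
    rintro ⟨α, β, c⟩ h
    rw [hΦ] at h
    simp only at h
    have hc : c = 0 := by
      funext ℓ
      have h3 := congrArg (onLine ℓ.1) h
      rw [map_add, map_add, map_mul, map_mul, hFL _ ℓ.2, hJL _ ℓ.2, zero_mul, zero_mul, zero_add,
        zero_add, map_zero, map_sum, sum_eq_single ℓ] at h3
      · rw [map_mul] at h3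
        exact eq_zero_of_onLine_polyY_eq_zero
          ((mul_eq_zero.1 h3).resolve_left (onLine_separator_ne_zero L ℓ.1))
      · intro m _ hm
        rw [map_mul, onLine_separator_eq_zero ℓ.2 (fun h => hm (Subtype.ext h.symm)), zero_mul]
      · simp
    subst hc
    simp only [Pi.zero_apply, map_zero, mul_zero, sum_const_zero, add_zero] at h
    have hβ : (β : MvPolynomial (Fin 3) K) = 0 := by
      by_contra h0
      have h3 : F ∣ J * β := ⟨-α, by linear_combination h⟩
      obtain ⟨γ, hγ⟩ := (hF.prime.dvd_or_dvd h3).resolve_left hJ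
      have hd := degreeOf_lt_of_mem_box β.2 (i := 2) h2
      rw [hγ, degreeOf_mul_eq hF.ne_zero (by rintro rfl; simp [hγ] at h0)] at hd
      simp [d2] at hd
    rw [hβ, mul_zero, add_zero] at h
    have hα := (mul_eq_zero.1 h).resolve_left hF.ne_zero
    ext1
    · exact Subtype.ext hα
    · ext1
      · exact Subtype.ext hβ
      · rfl
  have := LinearMap.finrank_le_finrank_of_injective hinj
  simpa [finrank_box, Module.finrank_prod, Module.finrank_pi_fintype, d1, d2, d3] using this

omit [DecidableEq K] in
/-- Parameter counting: there is a nonzero polynomial of small degree vanishing on given lines. -/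
lemma exists_ne_zero_onLine_eq_zero (L : Finset (K × K × K)) {D : ℕ} (hD : 3 * #L < D ^ 2) :
    ∃ F : MvPolynomial (Fin 3) K, F ≠ 0 ∧ boxDeg F ≤ 3 * D ∧ ∀ ℓ ∈ L, onLine ℓ F = 0 := by
  have hD0 : 0 < D := by
    rcases D.eq_zero_or_pos with rfl | h
    · simp at hD
    · exact h
  have hdeg : ∀ F ∈ box K (fun _ => D), boxDeg F < 3 * D := fun F hF => by
    have h := fun i => degreeOf_lt_of_mem_box hF (i := i) hD0
    have := h 0; have := h 1; have := h 2
    unfold boxDeg; omega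
  have hmem : ∀ ℓ : K × K × K, ∀ F : box K (fun _ => D),
      ((onLine ℓ).toLinearMap.comp (box K (fun _ => D)).subtype) F ∈
        Polynomial.degreeLT K (3 * D) := by
    intro ℓ F
    rw [Polynomial.mem_degreeLT]
    refine (Polynomial.degree_le_natDegree).trans_lt ?_
    exact_mod_cast (natDegree_onLine_le ℓ F.1).trans_lt (hdeg _ F.2)
  let Φ : box K (fun _ => D) →ₗ[K] (L → Polynomial.degreeLT K (3 * D)) :=
    LinearMap.pi fun ℓ => LinearMap.codRestrict _
      ((onLine ℓ.1).toLinearMap.comp (box K (fun _ => D)).subtype) (hmem ℓ.1)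
  have : FiniteDimensional K (Polynomial.degreeLT K (3 * D)) :=
    Module.Finite.equiv (Polynomial.degreeLTEquiv K (3 * D)).symm
  have hlt : Module.finrank K (L → Polynomial.degreeLT K (3 * D)) <
      Module.finrank K (box K (fun _ => D)) := by
    rw [finrank_box, Module.finrank_pi_fintype]
    simp only [(Polynomial.degreeLTEquiv K (3 * D)).finrank_eq, Module.finrank_fin_fun, sum_const,
      card_univ, Fintype.card_coe, smul_eq_mul]
    nlinarith
  obtain ⟨F, hF, hF0⟩ :=
    (Submodule.ne_bot_iff _).1 (LinearMap.ker_ne_bot_of_finrank_lt (f := Φ) hlt)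
  refine ⟨F.1, fun h => hF0 (Subtype.ext h), (hdeg _ F.2).le, fun ℓ hℓ => ?_⟩
  have := congrFun (LinearMap.mem_ker.1 hF) ⟨ℓ, hℓ⟩
  exact congrArg Subtype.val this

end Bezout

section Ruling
open MvPolynomial

/-- The coefficientwise extension of a derivation to the polynomial ring. -/
noncomputable def mapCoeffsSelf {R A : Type*} [CommRing R] [CommRing A] [Algebra R A]
    (D : Derivation R A A) : Derivation R (Polynomial A) (Polynomial A) :=
  PolynomialModule.equivPolynomialSelf.toLinearMap.compDer D.mapCoeffs

section
variable {R A : Type*} [CommRing R] [CommRing A] [Algebra R A] (D : Derivation R A A)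

lemma coeff_mapCoeffsSelf (f : Polynomial A) (n : ℕ) :
    (mapCoeffsSelf D f).coeff n = D (f.coeff n) := rfl

lemma mapCoeffsSelf_X : mapCoeffsSelf D Polynomial.X = 0 := by
  simp [mapCoeffsSelf]

lemma mapCoeffsSelf_C (a : A) : mapCoeffsSelf D (Polynomial.C a) = Polynomial.C (D a) := by
  ext n
  rw [coeff_mapCoeffsSelf, Polynomial.coeff_C, Polynomial.coeff_C]
  split_ifs <;> simp

end

variable {K : Type*} [Field K]

/-- The derivation tangent to the plane sections `X = const` of the surface `F = 0`. -/
noncomputable def tangentDer (F : MvPolynomial (Fin 3) K) :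
    Derivation K (MvPolynomial (Fin 3) K) (MvPolynomial (Fin 3) K) :=
  pderiv 2 F • pderiv 1 - pderiv 1 F • pderiv 2

lemma tangentDer_apply (F H : MvPolynomial (Fin 3) K) :
    tangentDer F H = pderiv 2 F * pderiv 1 H - pderiv 1 F * pderiv 2 H := by
  simp [tangentDer]

/-- The coordinates of a point moving along the tangent line of a plane section. -/
noncomputable def tangentLine (F : MvPolynomial (Fin 3) K) :
    Fin 3 → Polynomial (MvPolynomial (Fin 3) K) :=
  ![Polynomial.C (X 0), Polynomial.C (X 1) + Polynomial.C (pderiv 2 F) * Polynomial.X,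
    Polynomial.C (X 2) - Polynomial.C (pderiv 1 F) * Polynomial.X]

lemma mapCoeffsSelf_tangentLine (F : MvPolynomial (Fin 3) K) :
    Polynomial.C (pderiv 2 F) * mapCoeffsSelf (tangentDer F) (aeval (tangentLine F) F) =
      Polynomial.C (pderiv 2 F) * Polynomial.derivative (aeval (tangentLine F) F)
      + Polynomial.X * (Polynomial.C (tangentDer F (pderiv 2 F)) *
        Polynomial.derivative (aeval (tangentLine F) F)
      - Polynomial.C (curv F) * aeval (tangentLine F) (pderiv 2 F)) := by
  have h1 := derivation_aeval (mapCoeffsSelf (tangentDer F)) (tangentLine F) F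
  have h2 := derivation_aeval
    ((Polynomial.derivative' (R := MvPolynomial (Fin 3) K)).restrictScalars K) (tangentLine F) F
  simp only [Derivation.coe_restrictScalars, Polynomial.derivative'_apply] at h2
  rw [h1, h2]
  simp only [Fin.sum_univ_three, tangentLine]
  simp [mapCoeffsSelf_C, mapCoeffsSelf_X, tangentDer_apply, curv, pderiv_X]
  ring

lemma dvd_coeff_tangentLine {p : ℕ} [CharP K p] {F : MvPolynomial (Fin 3) K}
    (hF : Irreducible F) (hG : F ∣ curv F) (hZ : ¬ F ∣ pderiv 2 F) (hp : boxDeg F < p) (j : ℕ) :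
    F ∣ (aeval (tangentLine F) F).coeff j := by
  have hprime := hF.prime
  induction j with
  | zero =>
    rw [Polynomial.coeff_zero_eq_eval_zero, ← Polynomial.coe_aeval_eq_eval]
    have : (Polynomial.aeval (0 : MvPolynomial (Fin 3) K)) (aeval (tangentLine F) F) = F := by
      have := comp_aeval_apply (φ := (Polynomial.aeval
        (0 : MvPolynomial (Fin 3) K)).restrictScalars K) (tangentLine F) F
      rw [AlgHom.restrictScalars_apply] at this
      rw [this]
      have e : (fun i => ((Polynomial.aeval
        (0 : MvPolynomial (Fin 3) K)).restrictScalars K) (tangentLine F i)) = X := by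
        ext1 i
        fin_cases i <;> simp [tangentLine]
      rw [e, aeval_X_left_apply]
    rw [this]
  | succ j ih =>
    rcases lt_or_ge (boxDeg F) (j + 1) with hj | hj
    · rw [Polynomial.coeff_eq_zero_of_natDegree_lt]
      · exact dvd_zero _
      · refine (natDegree_aeval_le _ (fun i => ?_) F).trans_lt
          (by simpa [Fin.sum_univ_three, boxDeg] using hj)
        fin_cases i
        · simp [tangentLine]
        · exact (Polynomial.natDegree_add_le _ _).trans (max_le
            ((Polynomial.natDegree_C _).trans_le zero_le_one)
            ((Polynomial.natDegree_C_mul_le _ _).trans Polynomial.natDegree_X_le))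
        · exact (Polynomial.natDegree_sub_le _ _).trans (max_le
            ((Polynomial.natDegree_C _).trans_le zero_le_one)
            ((Polynomial.natDegree_C_mul_le _ _).trans Polynomial.natDegree_X_le))
    · have h := congrArg (Polynomial.coeff · j) (mapCoeffsSelf_tangentLine F)
      simp only [Polynomial.coeff_C_mul, Polynomial.coeff_add, coeff_mapCoeffsSelf] at h
      have hD : F ∣ tangentDer F ((aeval (tangentLine F) F).coeff j) := by
        obtain ⟨γ, hγ⟩ := ih
        rw [hγ, tangentDer_apply, Derivation.leibniz, Derivation.leibniz]
        simp only [smul_eq_mul]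
        exact ⟨pderiv 2 F * pderiv 1 γ - pderiv 1 F * pderiv 2 γ, by ring⟩
      have hX : F ∣ (Polynomial.X * (Polynomial.C (tangentDer F (pderiv 2 F)) *
          Polynomial.derivative (aeval (tangentLine F) F)
          - Polynomial.C (curv F) * aeval (tangentLine F) (pderiv 2 F))).coeff j := by
        rcases j with - | j
        · simp
        · rw [Polynomial.coeff_X_mul, Polynomial.coeff_sub, Polynomial.coeff_C_mul,
            Polynomial.coeff_C_mul, Polynomial.coeff_derivative]
          exact dvd_sub ((ih.mul_right _).mul_left _) (hG.mul_right _)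
      have h3 : F ∣ pderiv 2 F * (Polynomial.derivative (aeval (tangentLine F) F)).coeff j := by
        rw [← sub_eq_iff_eq_add] at h
        rw [← h]
        exact dvd_sub (hD.mul_left _) hX
      have h4 := (hprime.dvd_or_dvd h3).resolve_left hZ
      rw [Polynomial.coeff_derivative] at h4
      refine (hprime.dvd_or_dvd h4).resolve_right fun h5 => hF.not_isUnit ?_
      refine isUnit_of_dvd_unit h5 ?_
      have h6 : ((j + 1 : ℕ) : K) ≠ 0 := by
        rw [Ne, CharP.cast_eq_zero_iff K p]
        exact fun h => absurd (Nat.le_of_dvd (Nat.succ_pos _) h) (by omega)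
      have := (isUnit_iff_ne_zero.2 h6).map (C : K →+* MvPolynomial (Fin 3) K)
      simpa using this

/-- An irreducible surface of small degree all of whose plane sections `X = const` have vanishing
curvature is ruled by lines in these planes. -/
lemma exists_onLine_eq_zero [Infinite K] {p : ℕ} [CharP K p] {F : MvPolynomial (Fin 3) K}
    (hF : Irreducible F) (hG : F ∣ curv F) (hZ : ¬ F ∣ pderiv 2 F) (hp : boxDeg F < p)
    {x y z : K} (h0 : eval ![x, y, z] F = 0) (h1 : eval ![x, y, z] (pderiv 2 F) ≠ 0) :
    ∃ b c : K, b * y + c = z ∧ onLine (x, b, c) F = 0 := by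
  set u := eval ![x, y, z] (pderiv 2 F) with hu
  set v := eval ![x, y, z] (pderiv 1 F) with hv
  have key : ∀ s : K, eval ![x, y + u * s, z - v * s] F = 0 := by
    intro s
    have hz : (aeval (tangentLine F) F).map (eval ![x, y, z]) = 0 := by
      ext j
      rw [Polynomial.coeff_map, Polynomial.coeff_zero]
      obtain ⟨γ, hγ⟩ := dvd_coeff_tangentLine hF hG hZ hp j
      rw [hγ, map_mul, h0, zero_mul]
    have h2 := congrArg (Polynomial.eval s) hz
    rw [Polynomial.eval_zero, Polynomial.eval_map, aeval_def, ← Polynomial.coe_eval₂RingHom,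
      hom_eval₂] at h2
    rw [← h2, eval, coe_eval₂Hom]
    congr 1
    · ext a; simp [Polynomial.algebraMap_apply]
    · ext i
      fin_cases i <;> simp [tangentLine, hu, hv]
  refine ⟨-v / u, z + v / u * y, by ring, ?_⟩
  refine Polynomial.funext fun t => ?_
  rw [eval_onLine, Polynomial.eval_zero, ← key ((t - y) / u)]
  congr 2
  ext i
  fin_cases i
  · simp
  · simp; field_simp; ring
  · simp; field_simp; ring

end Ruling

section Bilinear
open MvPolynomial

variable {K : Type*} [Field K]

lemma eval_swapXY (a b c : K) (F : MvPolynomial (Fin 3) K) :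
    eval ![a, b, c] (swapXY F) = eval ![b, a, c] F := by
  rw [swapXY, renameEquiv_apply, eval_rename]
  congr 2
  ext i
  fin_cases i <;> simp [Equiv.swap_apply_of_ne_of_ne]

lemma eval_aeval_update (v : Fin 3 → K) (q F : MvPolynomial (Fin 3) K) :
    eval v (aeval (Function.update X 2 q) F) = eval ![v 0, v 1, eval v q] F := by
  rw [aeval_eq_bind₁, eval, eval₂Hom_bind₁]
  congr 2
  ext i
  fin_cases i <;> simp

/-- An irreducible surface of small degree ruled in two ways is the graph of a bilinear function. -/
lemma exists_bilinear [Infinite K] {p : ℕ} [CharP K p] {F : MvPolynomial (Fin 3) K}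
    (hF : Irreducible F) (h2 : 0 < degreeOf 2 F) (hp : boxDeg F < p) (hG : F ∣ curv F)
    (hG' : swapXY F ∣ curv (swapXY F)) {ℓ : K × K × K} (hℓ : onLine ℓ F = 0)
    (hℓZ : onLine ℓ (pderiv 2 F) ≠ 0) :
    ∃ c₀ c₁ c₂ c₃ : K, ∀ m : K × K × K, onLine m (swapXY F) = 0 →
      m.2.1 = c₁ + c₃ * m.1 ∧ m.2.2 = c₀ + c₂ * m.1 := by
  classical
  obtain ⟨x₀, σ₀, κ₀⟩ := ℓ
  have hFZ : ¬ F ∣ pderiv 2 F := fun ⟨γ, h⟩ => hℓZ (by rw [h, map_mul, hℓ, zero_mul])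
  have hF' : Irreducible (swapXY F) := (MulEquiv.irreducible_iff (swapXY (K := K))).2 hF
  have hFZ' : ¬ swapXY F ∣ pderiv 2 (swapXY F) := by
    rwa [pderiv_two_swapXY, map_dvd_iff (swapXY (K := K))]
  obtain ⟨T, hT, hTcard⟩ : ∃ T : Finset K,
      (∀ t ∈ T, (onLine (x₀, σ₀, κ₀) (pderiv 2 F)).eval t ≠ 0) ∧
        #T = boxDeg F * boxDeg F + 1 := by
    have hfin := (Polynomial.rootSet_finite (onLine (x₀, σ₀, κ₀) (pderiv 2 F)) K).infinite_compl
    obtain ⟨T, hT, hc⟩ := hfin.exists_subset_card_eq (boxDeg F * boxDeg F + 1)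
    refine ⟨T, fun t ht h => hT ht ?_, hc⟩
    exact (Polynomial.mem_rootSet.2 ⟨hℓZ, by simpa using h⟩)
  have hm : ∀ t ∈ T, ∃ b c : K, b * x₀ + c = σ₀ * t + κ₀ ∧ onLine (t, b, c) (swapXY F) = 0 := by
    intro t ht
    refine exists_onLine_eq_zero hF' hG' hFZ' (by rwa [boxDeg_swapXY]) ?_ ?_
    · have := congrArg (Polynomial.eval t) hℓ
      rwa [eval_onLine, Polynomial.eval_zero, ← eval_swapXY] at this
    · have := hT t ht
      rwa [eval_onLine, ← eval_swapXY, ← pderiv_two_swapXY] at this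
  choose! β γ hβ hβF using hm
  obtain ⟨x₁, hx₁, hx₁T⟩ : ∃ x₁, x₁ ≠ x₀ ∧
      ∀ t ∈ T, eval ![x₁, t, β t * x₁ + γ t] (pderiv 2 F) ≠ 0 := by
    have hne : (Polynomial.X - Polynomial.C x₀) *
        ∏ t ∈ T, onLine (t, β t, γ t) (swapXY (pderiv 2 F)) ≠ 0 := by
      refine mul_ne_zero (Polynomial.X_sub_C_ne_zero _) (prod_ne_zero_iff.2 fun t ht h => ?_)
      have := congrArg (Polynomial.eval x₀) h
      rw [eval_onLine_swapXY, hβ t ht, Polynomial.eval_zero] at this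
      have h3 := hT t ht
      rw [eval_onLine] at h3
      exact h3 this
    by_contra! hcon
    refine hne (Polynomial.funext fun x => ?_)
    rw [Polynomial.eval_mul, Polynomial.eval_zero, Polynomial.eval_prod]
    rcases eq_or_ne x x₀ with rfl | hx
    · simp
    · obtain ⟨t, ht, h⟩ := hcon x hx
      exact mul_eq_zero_of_right _ (prod_eq_zero ht (by rw [eval_onLine_swapXY]; exact h))
  have hl : ∀ t ∈ T, ∃ q : K × K, q.1 * t + q.2 = β t * x₁ + γ t ∧ onLine (x₁, q) F = 0 := by
    intro t ht
    obtain ⟨b, c, h, h'⟩ := exists_onLine_eq_zero hF hG hFZ hp (x := x₁) (y := t)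
      (z := β t * x₁ + γ t) (by
        have := congrArg (Polynomial.eval x₁) (hβF t ht)
        rwa [eval_onLine_swapXY, Polynomial.eval_zero] at this) (hx₁T t ht)
    exact ⟨(b, c), h, h'⟩
  choose! g hg hgF using hl
  have hcard : #(T.image g) ≤ boxDeg F :=
    (card_le_degreeOf_two (not_X_sub_C_dvd hF h2 x₁) (fun q hq => by
      obtain ⟨t, ht, rfl⟩ := mem_image.1 hq
      exact hgF t ht)).trans (degreeOf_le_boxDeg 2 F)
  obtain ⟨⟨σ₁, κ₁⟩, -, hfib⟩ := exists_lt_card_fiber_of_mul_lt_card_of_maps_to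
    (s := T) (t := T.image g) (f := g) (n := boxDeg F) (fun t ht => mem_image_of_mem g ht)
    ((Nat.mul_le_mul_right _ hcard).trans_lt (by omega))
  have hd : x₁ - x₀ ≠ 0 := sub_ne_zero.2 hx₁
  set c₃ := (σ₁ - σ₀) / (x₁ - x₀) with hc₃
  set c₁ := (κ₁ - κ₀) / (x₁ - x₀) with hc₁
  set c₂ := σ₀ - c₃ * x₀ with hc₂
  set c₀ := κ₀ - c₁ * x₀ with hc₀
  have e3 : c₃ * (x₁ - x₀) = σ₁ - σ₀ := div_mul_cancel₀ _ hd
  have e1 : c₁ * (x₁ - x₀) = κ₁ - κ₀ := div_mul_cancel₀ _ hd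
  have hz : ∀ x y : K, eval ![x, y, (c₂ + c₃ * x) * y + (c₀ + c₁ * x)] F = 0 := by
    intro x y
    have h0 : onLine (x, c₂ + c₃ * x, c₀ + c₁ * x) F = 0 := by
      refine Polynomial.eq_zero_of_natDegree_lt_card_of_eval_eq_zero' _ _ (fun t ht => ?_)
        ((natDegree_onLine_le _ F).trans_lt hfib)
      obtain ⟨htT, htg⟩ := mem_filter.1 ht
      have h3 := hβ t htT
      have h4 := hg t htT
      rw [htg] at h4
      simp only at h4
      have hβt : β t = c₁ + c₃ * t :=
        mul_right_cancel₀ hd (by linear_combination h4.symm - h3 - e1 - t * e3)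
      have hγt : γ t = c₀ + c₂ * t := by
        rw [hβt] at h3
        rw [hc₀, hc₂]
        linear_combination h3
      have h5 := congrArg (Polynomial.eval x) (hβF t htT)
      rw [eval_onLine_swapXY, Polynomial.eval_zero] at h5
      rw [eval_onLine, ← h5, hβt, hγt]
      congr 3
      ext i
      fin_cases i <;> simp
      ring
    rw [← Polynomial.eval_zero (x := y), ← h0, eval_onLine]
  set q : MvPolynomial (Fin 3) K := (C c₂ + C c₃ * X 0) * X 1 + (C c₀ + C c₁ * X 0) with hq
  have hdvd : X 2 - q ∣ F := by
    have h := X_sub_dvd_sub_aeval_update 2 q F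
    have h0 : aeval (Function.update X 2 q) F = 0 := MvPolynomial.funext fun v => by
      rw [eval_aeval_update, map_zero, ← hz (v 0) (v 1)]
      simp [hq]
    rwa [h0, sub_zero] at h
  have hunit : ¬ IsUnit (X 2 - q) := fun h => by
    have := h.map (eval ![0, 0, c₀])
    simp [hq] at this
  have hdvd' : F ∣ X 2 - q := by
    obtain ⟨r, hr⟩ := hdvd
    rw [hr]
    exact (associated_mul_unit_left _ r ((hF.isUnit_or_isUnit hr).resolve_left hunit)).dvd
  refine ⟨c₀, c₁, c₂, c₃, fun m hm => ?_⟩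
  have h := map_dvd (swapXY (K := K)) hdvd'
  have h3 : onLine m (swapXY (X 2 - q)) = 0 := by
    obtain ⟨r, hr⟩ := h
    rw [hr, map_mul, hm, zero_mul]
  have h4 := congrArg (Polynomial.eval 0) h3
  have h5 := congrArg (Polynomial.eval 1) h3
  rw [eval_onLine_swapXY, Polynomial.eval_zero] at h4 h5
  simp [hq] at h4 h5
  constructor
  · linear_combination h5 - h4
  · linear_combination h4

end Bilinear

section Incidences
open MvPolynomial

variable {K : Type*} [Field K] [DecidableEq K]

instance (ℓ m : K × K × K) : Decidable (Meets ℓ m) :=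
  inferInstanceAs (Decidable (_ = _))

/-- The number of pairs of meeting lines. -/
def incidences (L M : Finset (K × K × K)) : ℕ := ∑ ℓ ∈ L, #{m ∈ M | Meets ℓ m}

/-- Lines of the family in the same coordinate plane are parallel. -/
def Spread (L : Finset (K × K × K)) : Prop := ∀ ℓ ∈ L, ∀ m ∈ L, ℓ.1 = m.1 → ℓ.2.1 = m.2.1

/-- Every bilinear surface `Z = c₀ + c₁X + c₂Y + c₃XY` contains at most `k` lines of the family. -/
def BilinearBounded (M : Finset (K × K × K)) (k : ℕ) : Prop :=
  ∀ c₀ c₁ c₂ c₃ : K, #{m ∈ M | m.2.1 = c₁ + c₃ * m.1 ∧ m.2.2 = c₀ + c₂ * m.1} ≤ k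

/-- An incidence bound for all small subfamilies. -/
def SubBound (L M : Finset (K × K × K)) (W k E : ℕ) : Prop :=
  ∀ L' ⊆ L, ∀ M' ⊆ M, ∀ s ≤ E, #L' + #M' ≤ 49 * s ^ 2 → incidences L' M' ≤ W * s ^ 3 + k * #L'

omit [Field K] [DecidableEq K] in
lemma Spread.mono {L L' : Finset (K × K × K)} (h : Spread L) (hL : L' ⊆ L) : Spread L' :=
  fun ℓ hℓ m hm => h ℓ (hL hℓ) m (hL hm)

lemma BilinearBounded.mono {M M' : Finset (K × K × K)} {k : ℕ} (h : BilinearBounded M k)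
    (hM : M' ⊆ M) : BilinearBounded M' k :=
  fun c₀ c₁ c₂ c₃ => (card_le_card (filter_subset_filter _ hM)).trans (h c₀ c₁ c₂ c₃)

lemma SubBound.mono {L M L' M' : Finset (K × K × K)} {W k E : ℕ} (h : SubBound L M W k E)
    (hL : L' ⊆ L) (hM : M' ⊆ M) : SubBound L' M' W k E :=
  fun _ h1 _ h2 => h _ (h1.trans hL) _ (h2.trans hM)

lemma incidences_comm (L M : Finset (K × K × K)) : incidences L M = incidences M L := by
  refine (sum_card_bipartiteAbove_eq_sum_card_bipartiteBelow Meets).trans ?_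
  refine sum_congr rfl fun m _ => congrArg card (filter_congr fun ℓ _ => ?_)
  exact ⟨Meets.symm, Meets.symm⟩

lemma incidences_le_mul {L M : Finset (K × K × K)} {c : ℕ}
    (h : ∀ ℓ ∈ L, #{m ∈ M | Meets ℓ m} ≤ c) : incidences L M ≤ c * #L :=
  (sum_le_card_nsmul _ _ _ h).trans_eq (by rw [smul_eq_mul, mul_comm])

lemma incidences_le_card_mul_card (L M : Finset (K × K × K)) : incidences L M ≤ #M * #L :=
  incidences_le_mul fun _ _ => card_filter_le _ _

lemma incidences_filter_add (L M : Finset (K × K × K)) (P : K × K × K → Prop) [DecidablePred P] :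
    incidences L M = incidences {ℓ ∈ L | P ℓ} M + incidences {ℓ ∈ L | ¬ P ℓ} M :=
  (sum_filter_add_sum_filter_not L P _).symm

lemma card_filter_meets_le {M : Finset (K × K × K)} (hM : Spread M) {J : MvPolynomial (Fin 3) K}
    (hJM : ∀ m ∈ M, onLine m (swapXY J) = 0) {ℓ : K × K × K} (hℓ : onLine ℓ J ≠ 0) :
    #{m ∈ M | Meets ℓ m} ≤ boxDeg J := by
  have hinj : Set.InjOn Prod.fst ((M.filter (Meets ℓ) : Finset (K × K × K)) : Set (K × K × K)) := by
    intro m hm m' hm' h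
    obtain ⟨hm, e⟩ := mem_filter.1 (mem_coe.1 hm)
    obtain ⟨hm', e'⟩ := mem_filter.1 (mem_coe.1 hm')
    have hb := hM m hm m' hm' h
    unfold Meets at e e'
    refine Prod.ext h (Prod.ext hb ?_)
    rw [h, hb] at e
    exact add_left_cancel (e.symm.trans e')
  rw [← card_image_of_injOn hinj]
  refine le_trans ?_ (natDegree_onLine_le ℓ J)
  refine (card_le_card (t := (onLine ℓ J).roots.toFinset) fun t ht => ?_).trans
    ((Multiset.toFinset_card_le _).trans (Polynomial.card_roots' _))
  obtain ⟨m, hm, rfl⟩ := mem_image.1 ht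
  obtain ⟨hm, e⟩ := mem_filter.1 hm
  rw [Multiset.mem_toFinset, Polynomial.mem_roots hℓ, Polynomial.IsRoot, e.eval_eq, hJM m hm,
    Polynomial.eval_zero]

/-- Incidences with lines not contained in a surface containing the first family. -/
lemma incidences_le_of_onLine_eq_zero {L M : Finset (K × K × K)} (hL : Spread L)
    {J : MvPolynomial (Fin 3) K} (hJL : ∀ ℓ ∈ L, onLine ℓ J = 0) {c : ℕ} (hc : boxDeg J ≤ c) :
    incidences L M ≤ incidences L {m ∈ M | onLine m (swapXY J) = 0} + c * #M := by
  rw [incidences_comm L M, incidences_filter_add M L fun m => onLine m (swapXY J) = 0,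
    incidences_comm L]
  refine Nat.add_le_add_left ((incidences_le_mul fun m hm => ?_).trans
    (Nat.mul_le_mul_left c (card_filter_le _ _))) _
  refine (card_filter_meets_le hL (J := swapXY J) (fun ℓ hℓ => ?_) (mem_filter.1 hm).2).trans
    (by rwa [boxDeg_swapXY])
  rw [swapXY_swapXY, hJL ℓ hℓ]

/-- Incidences between lines in an irreducible surface, the first family being contained in a
second surface. -/
lemma exists_incidences_le_of_not_dvd {F J : MvPolynomial (Fin 3) K} (hF : Irreducible F)
    (h2 : 0 < degreeOf 2 F) (hJ : ¬ F ∣ J) (hJdeg : boxDeg J ≤ 3 * boxDeg F)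
    {L M : Finset (K × K × K)} (hL : Spread L) (hFL : ∀ ℓ ∈ L, onLine ℓ F = 0)
    (hFM : ∀ m ∈ M, onLine m (swapXY F) = 0) (hJL : ∀ ℓ ∈ L, onLine ℓ J = 0) :
    ∃ M' ⊆ M, #L + #M' ≤ 48 * boxDeg F ^ 2 ∧
      incidences L M ≤ incidences L M' + 3 * boxDeg F * #M := by
  refine ⟨_, filter_subset _ _, ?_, incidences_le_of_onLine_eq_zero hL hJL hJdeg⟩
  have h1 := card_lines_le hF h2 hJ hFL hJL
  have h3 := card_lines_le (F := swapXY F) (J := swapXY J)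
    ((MulEquiv.irreducible_iff (swapXY (K := K))).2 hF) (by rwa [degreeOf_swapXY_two])
    (by rwa [map_dvd_iff (swapXY (K := K))]) (L := {m ∈ M | onLine m (swapXY J) = 0})
    (fun m hm => hFM m (mem_filter.1 hm).1) (fun m hm => (mem_filter.1 hm).2)
  rw [boxDeg_swapXY, boxDeg_swapXY] at h3
  have := Nat.mul_le_mul_left (8 * boxDeg F) hJdeg
  nlinarith

omit [DecidableEq K] in
lemma dvd_X_sub_C_of_onLine_eq_zero [Infinite K] {F : MvPolynomial (Fin 3) K} (hF : Irreducible F)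
    (h2 : degreeOf 2 F = 0) {ℓ : K × K × K} (hℓ : onLine ℓ F = 0) : F ∣ X 0 - C ℓ.1 := by
  have h := X_sub_dvd_sub_aeval_update 0 (C ℓ.1) F
  have h0 : aeval (Function.update X 0 (C ℓ.1)) F = 0 := MvPolynomial.funext fun v => by
    have h3 := congrArg (Polynomial.eval (v 1)) hℓ
    rw [eval_onLine, Polynomial.eval_zero] at h3
    rw [map_zero, ← h3, aeval_eq_bind₁, eval, eval₂Hom_bind₁]
    refine eval₂Hom_congr' rfl (fun i hi _ => ?_) rfl
    have hi2 : i ≠ 2 := fun h => mem_vars_iff_degreeOf_ne_zero.1 hi (h ▸ h2)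
    fin_cases i
    · simp
    · simp
    · exact absurd rfl hi2
  rw [h0, sub_zero] at h
  obtain ⟨r, hr⟩ := h
  have hunit : ¬ IsUnit (X 0 - C ℓ.1 : MvPolynomial (Fin 3) K) := fun h => by
    simpa using h.map (eval fun _ => ℓ.1)
  rw [hr]
  exact (associated_mul_unit_left _ r ((hF.isUnit_or_isUnit hr).resolve_left hunit)).dvd

lemma incidences_le_of_irreducible_of_subset [Infinite K] {p : ℕ} [CharP K p]
    {F : MvPolynomial (Fin 3) K}
    (hF : Irreducible F) {E : ℕ} (hE : boxDeg F ≤ E) (hp : E < p)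
    {L M : Finset (K × K × K)} (hL : Spread L)
    (hM : Spread M) {k k' W : ℕ} (hk : BilinearBounded M k) (hW : SubBound L M W k' E)
    (hFL : ∀ ℓ ∈ L, onLine ℓ F = 0) (hFM : ∀ m ∈ M, onLine m (swapXY F) = 0) :
    incidences L M ≤ 3 * boxDeg F * (#L + #M) + (k + k') * #L + W * boxDeg F ^ 3 := by
  rcases L.eq_empty_or_nonempty with rfl | ⟨ℓ₀, hℓ₀⟩
  · simp [incidences]
  rcases Nat.eq_zero_or_pos (degreeOf 2 F) with h2 | h2
  · have hdvd := dvd_X_sub_C_of_onLine_eq_zero hF h2 (hFL ℓ₀ hℓ₀)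
    rcases M.eq_empty_or_nonempty with rfl | ⟨m₀, hm₀⟩
    · simp [incidences]
    · obtain ⟨r, hr⟩ := hdvd
      have h3 : onLine m₀ (swapXY (X 0 - C ℓ₀.1)) = 0 := by
        rw [hr, map_mul, map_mul, hFM m₀ hm₀, zero_mul]
      have := congrArg (Polynomial.eval (ℓ₀.1 + 1)) h3
      rw [eval_onLine_swapXY] at this
      simp at this
  have caseL : ∀ J : MvPolynomial (Fin 3) K, ¬ F ∣ J → boxDeg J ≤ 3 * boxDeg F →
      (∀ ℓ ∈ L, onLine ℓ J = 0) →
      incidences L M ≤ 3 * boxDeg F * (#L + #M) + (k + k') * #L + W * boxDeg F ^ 3 := by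
    intro J hJ hdeg hJL
    obtain ⟨M', hM', h1, h3⟩ := exists_incidences_le_of_not_dvd hF h2 hJ hdeg hL hFL hFM hJL
    have h4 := hW L subset_rfl M' hM' (boxDeg F) hE (by omega)
    nlinarith [Nat.zero_le (3 * boxDeg F * #L), Nat.zero_le (k * #L)]
  have hF' : Irreducible (swapXY F) := (MulEquiv.irreducible_iff (swapXY (K := K))).2 hF
  by_cases hG : F ∣ curv F
  swap
  · exact caseL _ hG (boxDeg_curv_le F) fun ℓ hℓ => onLine_curv (hFL ℓ hℓ)
  by_cases hG' : swapXY F ∣ curv (swapXY F)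
  swap
  · obtain ⟨L', hL', h1, h3⟩ := exists_incidences_le_of_not_dvd hF'
      (by rwa [degreeOf_swapXY_two]) hG' (boxDeg_curv_le _) hM hFM
      (fun ℓ hℓ => by rw [swapXY_swapXY]; exact hFL ℓ hℓ) fun m hm => onLine_curv (hFM m hm)
    rw [boxDeg_swapXY] at h1 h3
    rw [incidences_comm M L, incidences_comm M L'] at h3
    have h4 := hW L' hL' M subset_rfl (boxDeg F) hE (by omega)
    have h5 := Nat.mul_le_mul_left k' (card_le_card hL')
    nlinarith [Nat.zero_le (3 * boxDeg F * #M), Nat.zero_le (k * #L)]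
  have hFZ : ¬ F ∣ pderiv 2 F := by
    have hne : pderiv 2 F ≠ 0 := pderiv_ne_zero (p := p) 2 h2
      ((degreeOf_le_boxDeg 2 F).trans_lt (hE.trans_lt hp))
    rintro ⟨γ, hγ⟩
    have h3 := degreeOf_pderiv_self_lt 2 h2
    have h4 : γ ≠ 0 := by rintro rfl; simp [hne] at hγ
    rw [hγ, degreeOf_mul_eq hF.ne_zero h4] at h3
    omega
  by_cases hall : ∀ ℓ ∈ L, onLine ℓ (pderiv 2 F) = 0
  · exact caseL _ hFZ ((boxDeg_pderiv_le 2 F).trans (by omega)) hall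
  push Not at hall
  obtain ⟨ℓ, hℓ, hℓZ⟩ := hall
  obtain ⟨c₀, c₁, c₂, c₃, hc⟩ := exists_bilinear hF h2 (hE.trans_lt hp) hG hG' (hFL ℓ hℓ) hℓZ
  have hMk : #M ≤ k := by
    have := hk c₀ c₁ c₂ c₃
    rwa [filter_true_of_mem fun m hm => hc m (hFM m hm)] at this
  have h5 := incidences_le_card_mul_card L M
  have h6 := Nat.mul_le_mul_right #L hMk
  nlinarith [Nat.zero_le (3 * boxDeg F * (#L + #M)), Nat.zero_le (k' * #L),
    Nat.zero_le (W * boxDeg F ^ 3)]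

lemma incidences_le_of_irreducible [Infinite K] {p : ℕ} [CharP K p] {F : MvPolynomial (Fin 3) K}
    (hF : Irreducible F) {E : ℕ} (hE : boxDeg F ≤ E) (hp : E < p)
    {L M : Finset (K × K × K)} (hL : Spread L)
    (hM : Spread M) {k k' W : ℕ} (hk : BilinearBounded M k) (hW : SubBound L M W k' E)
    (hFL : ∀ ℓ ∈ L, onLine ℓ F = 0) :
    incidences L M ≤ 4 * boxDeg F * (#L + #M) + (k + k') * #L + W * boxDeg F ^ 3 := by
  have h1 := incidences_le_of_onLine_eq_zero (M := M) hL hFL le_rfl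
  have hsub := filter_subset (fun m => onLine m (swapXY F) = 0) M
  have h2 := incidences_le_of_irreducible_of_subset hF hE hp hL (hM.mono hsub) (hk.mono hsub)
    (hW.mono subset_rfl hsub) hFL fun m hm => (mem_filter.1 hm).2
  have h3 := card_le_card hsub
  have h4 := Nat.mul_le_mul_left (3 * boxDeg F) h3
  nlinarith [Nat.zero_le (boxDeg F * #L)]

/-- Incidences between two families of lines, the first being contained in a surface of small
degree. -/
lemma incidences_le_of_surface [Infinite K] {p : ℕ} [CharP K p] (F : MvPolynomial (Fin 3) K)
    (hF : F ≠ 0) {E : ℕ} (hE : boxDeg F ≤ E) (hp : E < p) {L M : Finset (K × K × K)} (hL : Spread L)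
    (hM : Spread M) {k k' W : ℕ} (hk : BilinearBounded M k) (hW : SubBound L M W k' E)
    (hFL : ∀ ℓ ∈ L, onLine ℓ F = 0) :
    incidences L M ≤ 4 * boxDeg F * (#L + #M) + (k + k') * #L + W * boxDeg F ^ 3 := by
  induction F using WfDvdMonoid.induction_on_irreducible generalizing L with
  | zero => exact absurd rfl hF
  | unit u hu =>
    rcases L.eq_empty_or_nonempty with rfl | ⟨ℓ, hℓ⟩
    · simp [incidences]
    · have := hu.map (onLine ℓ)
      rw [hFL ℓ hℓ] at this
      exact absurd this not_isUnit_zero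
  | mul a i ha hi ih =>
    rw [boxDeg_mul hi.ne_zero ha] at hE ⊢
    set L₁ := {ℓ ∈ L | onLine ℓ i = 0} with hL₁
    set L₂ := {ℓ ∈ L | ¬ onLine ℓ i = 0} with hL₂
    have s₁ : L₁ ⊆ L := filter_subset _ _
    have s₂ : L₂ ⊆ L := filter_subset _ _
    have h1 := incidences_le_of_irreducible hi (by omega) hp (hL.mono s₁) hM hk
      (hW.mono s₁ subset_rfl) fun ℓ hℓ => (mem_filter.1 hℓ).2
    have h2 := ih ha (by omega) (hL.mono s₂) (hW.mono s₂ subset_rfl) fun ℓ hℓ => by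
      have := hFL ℓ (mem_filter.1 hℓ).1
      rw [map_mul] at this
      exact (mul_eq_zero.1 this).resolve_left (mem_filter.1 hℓ).2
    rw [incidences_filter_add L M fun ℓ => onLine ℓ i = 0]
    have h3 : #L₁ + #L₂ = #L := card_filter_add_card_filter_not _
    rw [← h3]
    generalize boxDeg i = e₁ at *
    generalize boxDeg a = e₂ at *
    have h4 : W * e₁ ^ 3 + W * e₂ ^ 3 ≤ W * (e₁ + e₂) ^ 3 := by
      rw [← mul_add]
      refine Nat.mul_le_mul_left _ ?_
      nlinarith [Nat.zero_le (e₁ * e₂ * (e₁ + e₂))]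
    nlinarith [Nat.zero_le (e₁ * #L₂), Nat.zero_le (e₂ * #L₁)]

end Incidences

section IncidenceTheorem
open MvPolynomial

variable {K : Type*} [Field K] [DecidableEq K]

lemma incidences_add_of_subset {L L' M : Finset (K × K × K)} (h : L' ⊆ L) :
    incidences L M = incidences (L \ L') M + incidences L' M :=
  (sum_sdiff h).symm

/-- Cutting the first family into few pieces, each contained in a surface of small degree. -/
lemma incidences_le_of_card_le_mul [Infinite K] {p : ℕ} [CharP K p] {a D : ℕ} (hD : 3 * a < D ^ 2)
    (hp : 3 * D < p) {M : Finset (K × K × K)} (hM : Spread M) {k k' W : ℕ}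
    (hk : BilinearBounded M k) (j : ℕ) {L : Finset (K × K × K)} (hL : Spread L)
    (hW : SubBound L M W k' (3 * D)) (hj : #L ≤ j * a) :
    incidences L M ≤ j * (12 * D * (a + #M) + W * (3 * D) ^ 3) + (k + k') * #L := by
  induction j generalizing L with
  | zero =>
    have : L = ∅ := card_eq_zero.1 (by omega)
    simp [this, incidences]
  | succ j ih =>
    obtain ⟨L', hL', hc⟩ := exists_subset_card_eq (min_le_right a #L)
    have h1 := card_sdiff_add_card_eq_card hL'
    have h2 := ih (L := L \ L') (hL.mono sdiff_subset) (hW.mono sdiff_subset subset_rfl)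
      (by rw [add_one_mul] at hj; omega)
    obtain ⟨F, hF, hdeg, hFL⟩ := exists_ne_zero_onLine_eq_zero L' (D := D) (by omega)
    have h3 := incidences_le_of_surface F hF hdeg hp (hL.mono hL') hM hk
      (hW.mono hL' subset_rfl) hFL
    have ha : #L' ≤ a := by omega
    have h4 : 4 * boxDeg F * (#L' + #M) ≤ 12 * D * (a + #M) :=
      Nat.mul_le_mul (by omega) (by omega)
    have h5 : W * boxDeg F ^ 3 ≤ W * (3 * D) ^ 3 :=
      Nat.mul_le_mul_left _ (Nat.pow_le_pow_left hdeg 3)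
    rw [incidences_add_of_subset hL', ← h1]
    nlinarith

/-- The incidence bound for two families of lines parallel to coordinate planes. -/
theorem incidences_le [Infinite K] {p : ℕ} [CharP K p] (hp : 0 < p) {k : ℕ} (t : ℕ)
    {L M : Finset (K × K × K)} (hL : Spread L) (hM : Spread M)
    (hk : BilinearBounded M k) (hN : #L + #M ≤ 2 * p ^ 2) (ht : #L + #M < 2 ^ t) :
    (incidences L M : ℝ) ≤
      15000000 * ((#L + #M : ℕ) * √(#L + #M : ℕ)) + (k * t * #L : ℕ) := by
  induction t generalizing L M with
  | zero =>
    have : L = ∅ := card_eq_zero.1 (by omega)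
    simp only [this, incidences, sum_empty]
    push_cast
    positivity
  | succ t ih =>
    obtain ⟨N, hNdef⟩ : ∃ N, N = #L + #M := ⟨_, rfl⟩
    obtain ⟨y, hy⟩ : ∃ y : ℝ, y = √(N : ℝ) := ⟨_, rfl⟩
    have hy0 : 0 ≤ y := hy ▸ Real.sqrt_nonneg _
    have hyN : y * y = N := hy ▸ Real.mul_self_sqrt (Nat.cast_nonneg _)
    rw [← hNdef, ← hy]
    rcases lt_or_ge N (100 * 150000 ^ 2) with hsmall | hbig
    · have h1 : incidences L M ≤ N * N :=
        (incidences_le_card_mul_card L M).trans (Nat.mul_le_mul (by omega) (by omega))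
      have h2 : (incidences L M : ℝ) ≤ N * N := by exact_mod_cast h1
      have h3 : y ≤ 1500000 := by
        refine abs_le_of_sq_le_sq' ?_ (by norm_num) |>.2
        have : (N : ℝ) < 100 * 150000 ^ 2 := by exact_mod_cast hsmall
        nlinarith
      have h4 : (0 : ℝ) ≤ (k * (t + 1) * #L : ℕ) := Nat.cast_nonneg _
      have h5 : (N : ℝ) * N ≤ N * (1500000 * y) := by
        refine mul_le_mul_of_nonneg_left ?_ (Nat.cast_nonneg _)
        nlinarith
      have h6 : (0 : ℝ) ≤ N * y := mul_nonneg (Nat.cast_nonneg _) hy0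
      linarith
    · obtain ⟨a, ha⟩ : ∃ a, a = #L / 150000 ^ 2 + 1 := ⟨_, rfl⟩
      obtain ⟨D, hD⟩ : ∃ D, D = Nat.sqrt (3 * a) + 1 := ⟨_, rfl⟩
      obtain ⟨w, hw⟩ : ∃ w : ℝ, w = y / 150000 := ⟨_, rfl⟩
      have hyw : y = 150000 * w := by rw [hw]; ring
      have hw10 : 10 ≤ w := by
        have h1 : (100 * 150000 ^ 2 : ℝ) ≤ N := by exact_mod_cast hbig
        have h2 : (1500000 : ℝ) ≤ y := by
          refine abs_le_of_sq_le_sq' ?_ hy0 |>.2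
          nlinarith
        linarith
      have haw : (a : ℝ) ≤ w ^ 2 + 1 := by
        have h1 : 150000 ^ 2 * (#L / 150000 ^ 2) ≤ N := (Nat.mul_div_le _ _).trans (by omega)
        have h2 : (150000 ^ 2 * (#L / 150000 ^ 2 : ℕ) : ℝ) ≤ N := by exact_mod_cast h1
        rw [ha]
        push_cast at h2 ⊢
        rw [← hyN, hyw] at h2
        nlinarith
      have hDw : (D : ℝ) ≤ 2 * w := by
        have h1 : Nat.sqrt (3 * a) ^ 2 ≤ 3 * a := Nat.sqrt_le' _
        have h2 : ((Nat.sqrt (3 * a) : ℕ) : ℝ) ^ 2 ≤ 3 * a := by exact_mod_cast h1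
        have h3 : ((Nat.sqrt (3 * a) : ℕ) : ℝ) ≤ 2 * w - 1 := by
          refine abs_le_of_sq_le_sq' ?_ (by linarith) |>.2
          nlinarith
        rw [hD]
        push_cast
        linarith
      have hDD : 3 * a < D ^ 2 := hD ▸ Nat.lt_succ_sqrt' _
      have hDp : 3 * D < p := by
        have h1 : (N : ℝ) ≤ 2 * p ^ 2 := by exact_mod_cast hNdef ▸ hN
        have h2 : (0 : ℝ) < p := by exact_mod_cast hp
        have h3 : w < p / 6 := by
          refine abs_lt_of_sq_lt_sq' ?_ (by linarith) |>.2
          rw [← hyN, hyw] at h1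
          nlinarith [mul_pos h2 h2]
        have h4 : (3 * D : ℝ) < p := by linarith
        exact_mod_cast h4
      have hsub : SubBound L M (343 * 15000000) (k * t) (3 * D) := by
        intro L' hL' M' hM' s hs hc
        have hlt : #L' + #M' < 2 ^ t := by
          have h1 : (s : ℝ) ≤ 3 * D := by exact_mod_cast hs
          have h2 : (s : ℝ) ^ 2 ≤ (6 * w) ^ 2 :=
            pow_le_pow_left₀ (Nat.cast_nonneg _) (by linarith) 2
          have h3 : ((#L' + #M' : ℕ) : ℝ) ≤ 49 * s ^ 2 := by exact_mod_cast hc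
          have h4 : (N : ℝ) < 2 ^ (t + 1) := by exact_mod_cast hNdef ▸ ht
          have h5 : ((#L' + #M' : ℕ) : ℝ) < 2 ^ t := by
            rw [pow_succ, ← hyN, hyw] at h4
            nlinarith
          exact_mod_cast h5
        have h1 := ih (hL.mono hL') (hM.mono hM') (hk.mono hM')
          ((add_le_add (card_le_card hL') (card_le_card hM')).trans hN) hlt
        have h2 : ((#L' + #M' : ℕ) : ℝ) ≤ 49 * s ^ 2 := by exact_mod_cast hc
        have h3 : √((#L' + #M' : ℕ) : ℝ) ≤ 7 * s := Real.sqrt_le_iff.2 ⟨by positivity, by nlinarith⟩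
        have h4 : ((#L' + #M' : ℕ) : ℝ) * √((#L' + #M' : ℕ) : ℝ) ≤ 49 * s ^ 2 * (7 * s) :=
          mul_le_mul h2 h3 (Real.sqrt_nonneg _) (by positivity)
        have h5 : (incidences L' M' : ℝ) ≤
            ((343 * 15000000 * s ^ 3 + k * t * #L' : ℕ) : ℝ) := by
          push_cast at h1 h4 ⊢
          nlinarith
        exact_mod_cast h5
      have hja : #L ≤ 150000 ^ 2 * a := by
        rw [ha]
        omega
      have haN : a ≤ N := by omega
      have hMN : #M ≤ N := by omega
      have key := incidences_le_of_card_le_mul hDD hDp hM hk (150000 ^ 2) hL hsub hja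
      have key' : incidences L M ≤ 150000 ^ 2 * (12 * D * (N + N) +
          343 * 15000000 * (3 * D) ^ 3) + k * (t + 1) * #L := by
        refine key.trans ?_
        rw [show k * (t + 1) = k + k * t by ring]
        gcongr
      have key'' : (incidences L M : ℝ) ≤ 150000 ^ 2 * (12 * D * (N + N) +
          343 * 15000000 * (3 * D) ^ 3) + (k * (t + 1) * #L : ℕ) := by exact_mod_cast key'
      refine key''.trans (add_le_add_left ?_ _)
      have h1 : (D : ℝ) ^ 3 ≤ (2 * w) ^ 3 := pow_le_pow_left₀ (Nat.cast_nonneg _) hDw 3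
      have h2 : (D : ℝ) * N ≤ 2 * w * N := mul_le_mul_of_nonneg_right hDw (Nat.cast_nonneg _)
      have h3 : 0 ≤ w ^ 3 := by positivity
      rw [← hyN, hyw] at h2 ⊢
      nlinarith

end IncidenceTheorem

section Linking

variable {F K : Type*} [Field F] [Field K] [Algebra F K]

/-- The line attached to the triple `(d, c, t)`; two such lines meet precisely when
`(d + c')² + t' = (d' + c)² + t`. -/
def quadLine (α : K) (u : F × F × F) : K × K × K :=
  (algebraMap F K u.1 + α * algebraMap F K u.2.1, algebraMap F K (2 * u.2.1),
    algebraMap F K (u.2.1 ^ 2 + u.2.2 - u.1 ^ 2))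

lemma meets_quadLine {α : K} {u v : F × F × F}
    (h : (u.2.1 + v.1) ^ 2 + u.2.2 = (v.2.1 + u.1) ^ 2 + v.2.2) :
    Meets (quadLine α u) (quadLine α v) := by
  have := congrArg (algebraMap F K) h
  simp only [map_add, map_pow] at this
  simp only [Meets, quadLine, map_mul, map_sub, map_add, map_pow, map_ofNat]
  linear_combination this

lemma eq_of_add_mul_eq {α : K} (hα : α ∉ Set.range (algebraMap F K)) {d c d' c' : F}
    (h : algebraMap F K d + α * algebraMap F K c = algebraMap F K d' + α * algebraMap F K c') :
    d = d' ∧ c = c' := by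
  have hc : c = c' := by
    by_contra hne
    have h0 : algebraMap F K c - algebraMap F K c' ≠ 0 := by
      rwa [← map_sub, Ne, map_eq_zero, sub_eq_zero]
    refine hα ⟨(d' - d) / (c - c'), ?_⟩
    rw [map_div₀, map_sub, map_sub, div_eq_iff h0]
    linear_combination -h
  subst hc
  exact ⟨(algebraMap F K).injective (add_right_cancel h), rfl⟩

lemma quadLine_injective {α : K} (hα : α ∉ Set.range (algebraMap F K)) :
    Function.Injective (quadLine (F := F) α) := by
  rintro ⟨d, c, t⟩ ⟨d', c', t'⟩ h
  simp only [quadLine, Prod.mk.injEq] at h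
  obtain ⟨rfl, rfl⟩ := eq_of_add_mul_eq hα h.1
  have := (algebraMap F K).injective h.2.2
  rw [sub_left_inj, add_right_inj] at this
  rw [this]

variable [DecidableEq K]

omit [DecidableEq K] in
lemma spread_of_quadLine {α : K} (hα : α ∉ Set.range (algebraMap F K)) {L : Finset (K × K × K)}
    (hL : ∀ ℓ ∈ L, ∃ u : F × F × F, quadLine α u = ℓ) : Spread L := by
  intro ℓ hℓ m hm h
  obtain ⟨u, rfl⟩ := hL ℓ hℓ
  obtain ⟨v, rfl⟩ := hL m hm
  exact congrArg (fun c => algebraMap F K (2 * c)) (eq_of_add_mul_eq hα h).2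

lemma bilinearBounded_image_quadLine {α : K} (hα : α ∉ Set.range (algebraMap F K))
    (h2 : (2 : K) ≠ 0) {D A T : Finset F} {k : ℕ} (hD : #D ≤ k) (hA : #A ≤ k) :
    BilinearBounded ((D ×ˢ A ×ˢ T).image (quadLine α)) k := by
  intro c₀ c₁ c₂ c₃
  rw [filter_image]
  refine card_image_le.trans ?_
  set U := {u ∈ D ×ˢ A ×ˢ T | (quadLine α u).2.1 = c₁ + c₃ * (quadLine α u).1 ∧
    (quadLine α u).2.2 = c₀ + c₂ * (quadLine α u).1} with hU
  have hU1 : ∀ u ∈ U, u.1 ∈ D ∧ u.2.1 ∈ A ∧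
      (2 - c₃ * α) * algebraMap F K u.2.1 = c₁ + c₃ * algebraMap F K u.1 := by
    intro u hu
    obtain ⟨hu, h, -⟩ := mem_filter.1 hu
    simp only [mem_product] at hu
    simp only [quadLine, map_mul, map_ofNat] at h
    exact ⟨hu.1, hu.2.1, by linear_combination h⟩
  have hU2 : ∀ u ∈ U, ∀ v ∈ U, u.1 = v.1 → u.2.1 = v.2.1 → u = v := by
    intro u hu v hv h h'
    obtain ⟨-, -, hu⟩ := mem_filter.1 hu
    obtain ⟨-, -, hv⟩ := mem_filter.1 hv
    refine quadLine_injective hα (Prod.ext ?_ (Prod.ext ?_ ?_))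
    · simp only [quadLine, h, h']
    · simp only [quadLine, h']
    · rw [hu, hv]
      simp only [quadLine, h, h']
  by_cases h0 : 2 - c₃ * α = 0
  · have h3 : c₃ ≠ 0 := by
      rintro rfl
      simp [h2] at h0
    refine (card_le_card_of_injOn (fun u => u.2.1) (fun u hu => (hU1 u hu).2.1) ?_).trans hA
    intro u hu v hv h
    refine hU2 u hu v hv ?_ h
    have e1 := (hU1 u hu).2.2
    have e2 := (hU1 v hv).2.2
    rw [h0, zero_mul] at e1 e2
    exact (algebraMap F K).injective (mul_left_cancel₀ h3 (by linear_combination e2 - e1))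
  · refine (card_le_card_of_injOn (fun u => u.1) (fun u hu => (hU1 u hu).1) ?_).trans hD
    intro u hu v hv h
    refine hU2 u hu v hv h ?_
    have e1 := (hU1 u hu).2.2
    have e2 := (hU1 v hv).2.2
    simp only at h
    rw [h] at e1
    exact (algebraMap F K).injective (mul_left_cancel₀ h0 (e1.trans e2.symm))

lemma incidences_eq_card (L M : Finset (K × K × K)) :
    incidences L M = #{q ∈ L ×ˢ M | Meets q.1 q.2} := by
  rw [incidences, card_filter, sum_product]
  exact sum_congr rfl fun ℓ _ => card_filter _ _

lemma card_sq_mul_diffEnergy_le [Fintype F] [DecidableEq F] {α : K}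
    (hα : α ∉ Set.range (algebraMap F K)) (A T : Finset F) :
    #A ^ 2 * diffEnergy (A.image fun a => a ^ 2) T ≤
      incidences (((A - A) ×ˢ A ×ˢ T).image (quadLine α))
        (((A - A) ×ˢ A ×ˢ T).image (quadLine α)) := by
  set S := A.image fun a => a ^ 2 with hS
  have hroot : ∀ s ∈ S, ∃ a ∈ A, a ^ 2 = s := fun s hs => mem_image.1 hs
  choose! ρ hρA hρ using hroot
  have hcard : #A ^ 2 * diffEnergy S T = #((univ : Finset F).sigma fun x =>
      (shiftInter S x ×ˢ shiftInter T x) ×ˢ (A ×ˢ A)) := by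
    rw [card_sigma, diffEnergy, mul_sum]
    refine sum_congr rfl fun x _ => ?_
    rw [card_product, card_product, card_product]
    ring
  rw [hcard, incidences_eq_card]
  refine card_le_card_of_injOn (fun q => (quadLine α (ρ (q.2.1.1 + q.1) - q.2.2.1, q.2.2.2,
    q.2.1.2 + q.1), quadLine α (ρ q.2.1.1 - q.2.2.2, q.2.2.1, q.2.1.2))) ?_ ?_
  · rintro ⟨x, ⟨b, τ⟩, c, c'⟩ hq
    simp only [mem_coe, mem_sigma, mem_univ, mem_product, mem_shiftInter, true_and] at hq
    obtain ⟨⟨⟨hb, hb'⟩, hτ, hτ'⟩, hc, hc'⟩ := hq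
    refine mem_coe.2 (mem_filter.2 ⟨mem_product.2 ⟨mem_image_of_mem _ ?_, mem_image_of_mem _ ?_⟩,
      meets_quadLine ?_⟩)
    · simp only [mem_product]
      exact ⟨sub_mem_sub (hρA _ hb') hc, hc', hτ'⟩
    · simp only [mem_product]
      exact ⟨sub_mem_sub (hρA _ hb) hc', hc, hτ⟩
    · simp only [add_sub_cancel, hρ _ hb, hρ _ hb']
      ring
  · rintro ⟨x, ⟨b, τ⟩, c, c'⟩ hq ⟨y, ⟨e, σ⟩, f, f'⟩ hq' h
    simp only [mem_coe, mem_sigma, mem_univ, mem_product, mem_shiftInter, true_and] at hq hq'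
    simp only [Prod.mk.injEq] at h
    have h1 := quadLine_injective hα h.1
    have h3 := quadLine_injective hα h.2
    simp only [Prod.mk.injEq] at h1 h3
    obtain ⟨h4, rfl, h5⟩ := h1
    obtain ⟨h6, rfl, rfl⟩ := h3
    obtain rfl : x = y := add_left_cancel h5
    have h7 : b = e := by
      rw [← hρ b hq.1.1.1, ← hρ e hq'.1.1.1, sub_left_injective h6]
    rw [h7]

end Linking

section Conclusion

variable {p : ℕ} [Fact p.Prime]

lemma diffEnergy_le_card_mul_card_sq {G : Type*} [AddCommGroup G] [DecidableEq G] [Fintype G]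
    (S T : Finset G) : diffEnergy S T ≤ #S * #T ^ 2 := by
  rw [← sum_card_shiftInter T, mul_sum]
  exact sum_le_sum fun x _ => Nat.mul_le_mul_right _ (card_le_card (shiftInter_subset S x))

/-- Energy bound for the set of squares in terms of the difference set. -/
lemma card_sq_mul_diffEnergy_sqSet_le (hp2 : p ≠ 2) {A T : Finset (ZMod p)} (hA : A.Nonempty)
    (hT : #A * #(A - A) * #T ≤ p ^ 2) {t : ℕ} (ht : 2 * p ^ 2 < 2 ^ t) :
    (#A : ℝ) ^ 2 * diffEnergy (sqSet A) T ≤ (45000000 + t) *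
      ((#A * #(A - A) * #T : ℕ) * √(#A * #(A - A) * #T : ℕ)) := by
  classical
  have hp : p.Prime := Fact.out
  obtain ⟨n, hn⟩ : ∃ n, n = #A := ⟨_, rfl⟩
  obtain ⟨d, hd⟩ : ∃ d, d = #(A - A) := ⟨_, rfl⟩
  obtain ⟨m, hm⟩ : ∃ m, m = #T := ⟨_, rfl⟩
  obtain ⟨P, hP⟩ : ∃ P, P = n * d * m := ⟨_, rfl⟩
  obtain ⟨y, hy⟩ : ∃ y : ℝ, y = √(P : ℝ) := ⟨_, rfl⟩
  have hy0 : 0 ≤ y := hy ▸ Real.sqrt_nonneg _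
  have hyP : y * y = P := hy ▸ Real.mul_self_sqrt (Nat.cast_nonneg _)
  have hnd : n ≤ d := hn ▸ hd ▸ card_le_card_sub_left hA
  rw [← hn, ← hd, ← hm, ← hP] at hT
  rw [← hn, ← hd, ← hm, ← hP, ← hy]
  have ht0 : (0 : ℝ) ≤ t := Nat.cast_nonneg _
  have hPy : (0 : ℝ) ≤ P * y := mul_nonneg (Nat.cast_nonneg _) hy0
  rcases le_or_gt d (n * m) with hcase | hcase
  · obtain ⟨α, hα⟩ : ∃ α : AlgebraicClosure (ZMod p),
        α ∉ Set.range (algebraMap (ZMod p) (AlgebraicClosure (ZMod p))) :=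
      ((Set.finite_range _).infinite_compl).nonempty
    have : CharP (AlgebraicClosure (ZMod p)) p :=
      charP_of_injective_algebraMap (algebraMap (ZMod p) _).injective p
    have h2 : (2 : AlgebraicClosure (ZMod p)) ≠ 0 := by
      intro h
      have := (CharP.cast_eq_zero_iff (AlgebraicClosure (ZMod p)) p 2).1 (by exact_mod_cast h)
      exact hp2 ((Nat.prime_dvd_prime_iff_eq hp Nat.prime_two).1 this)
    obtain ⟨L, hL⟩ : ∃ L, L = ((A - A) ×ˢ A ×ˢ T).image (quadLine α) := ⟨_, rfl⟩
    have hLP : #L ≤ P := by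
      rw [hL, hP, hn, hd, hm]
      refine card_image_le.trans_eq ?_
      rw [card_product, card_product]
      ring
    have hLs : Spread L := spread_of_quadLine hα fun ℓ hℓ => by
      rw [hL] at hℓ
      obtain ⟨u, -, hu⟩ := mem_image.1 hℓ
      exact ⟨u, hu⟩
    have hLb : BilinearBounded L d :=
      hL ▸ bilinearBounded_image_quadLine hα h2 hd.ge (hn.symm.trans_le hnd)
    have h3 := incidences_le hp.pos t hLs hLs hLb (by omega) (by omega)
    have h4 : (n : ℝ) ^ 2 * diffEnergy (sqSet A) T ≤ incidences L L := by
      have := card_sq_mul_diffEnergy_le hα A T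
      rw [← hn, ← hL] at this
      exact_mod_cast this
    have h5 : ((#L + #L : ℕ) : ℝ) ≤ 2 * P := by
      have : #L + #L ≤ 2 * P := by omega
      exact_mod_cast this
    have h6 : √((#L + #L : ℕ) : ℝ) ≤ 3 / 2 * y :=
      Real.sqrt_le_iff.2 ⟨by linarith, by nlinarith [Nat.cast_nonneg (α := ℝ) P]⟩
    have h7 : ((#L + #L : ℕ) : ℝ) * √((#L + #L : ℕ) : ℝ) ≤ 2 * P * (3 / 2 * y) :=
      mul_le_mul h5 h6 (Real.sqrt_nonneg _) (by positivity)
    have h8 : (d : ℝ) ≤ y := by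
      refine abs_le_of_sq_le_sq' ?_ hy0 |>.2
      have : d * d ≤ P := by
        rw [hP, mul_comm n d, mul_assoc]
        exact Nat.mul_le_mul_left d hcase
      have : (d : ℝ) * d ≤ P := by exact_mod_cast this
      nlinarith
    have h9 : ((d * t * #L : ℕ) : ℝ) ≤ y * t * P := by
      push_cast
      have : (#L : ℝ) ≤ P := by exact_mod_cast hLP
      exact mul_le_mul (mul_le_mul_of_nonneg_right h8 ht0) this (Nat.cast_nonneg _)
        (mul_nonneg hy0 ht0)
    nlinarith
  · have h1 : diffEnergy (sqSet A) T ≤ n * m ^ 2 := by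
      refine (diffEnergy_le_card_mul_card_sq _ _).trans ?_
      rw [← hm, hn]
      exact Nat.mul_le_mul_right _ card_image_le
    have h2 : (n : ℝ) ^ 2 * diffEnergy (sqSet A) T ≤ n ^ 3 * m ^ 2 := by
      have : n ^ 2 * diffEnergy (sqSet A) T ≤ n ^ 3 * m ^ 2 :=
        (Nat.mul_le_mul_left _ h1).trans_eq (by ring)
      exact_mod_cast this
    have h3 : (n : ℝ) ^ 3 * m ^ 2 ≤ P * y := by
      refine abs_le_of_sq_le_sq' ?_ hPy |>.2
      have h4 : (n ^ 3 * m ^ 2) ^ 2 ≤ P ^ 3 := by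
        have h5 : n ^ 3 * m ≤ d ^ 3 := by
          refine le_trans ?_ (Nat.pow_le_pow_left hcase.le 3)
          rw [mul_pow]
          exact Nat.mul_le_mul_left _ (Nat.le_self_pow (by norm_num) m)
        calc (n ^ 3 * m ^ 2) ^ 2 = n ^ 3 * m ^ 3 * (n ^ 3 * m) := by ring
          _ ≤ n ^ 3 * m ^ 3 * d ^ 3 := Nat.mul_le_mul_left _ h5
          _ = P ^ 3 := by rw [hP]; ring
      have h6 : ((n : ℝ) ^ 3 * m ^ 2) ^ 2 ≤ P ^ 3 := by exact_mod_cast h4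
      calc ((n : ℝ) ^ 3 * m ^ 2) ^ 2 ≤ P ^ 3 := h6
        _ = P ^ 2 * (y * y) := by rw [hyP]; ring
        _ = (P * y) ^ 2 := by ring
    nlinarith

lemma card_le_two_mul_card_sqSet (A : Finset (ZMod p)) : #A ≤ 2 * #(sqSet A) := by
  refine card_le_mul_card_image (f := fun a : ZMod p => a ^ 2) A 2 fun s _ => ?_
  refine (card_le_card
    (t := (Polynomial.X ^ 2 - Polynomial.C s).roots.toFinset) fun a ha => ?_).trans
    ((Multiset.toFinset_card_le _).trans ((Polynomial.card_roots' _).trans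
      Polynomial.natDegree_X_pow_sub_C.le))
  rw [Multiset.mem_toFinset, Polynomial.mem_roots (Polynomial.X_pow_sub_C_ne_zero two_pos s)]
  simp [(mem_filter.1 ha).2]

/-- The lower bound for `|A² - A²|` with explicit logarithmic loss. -/
lemma card_pow_le_mul_card_sqDiff_pow (hp2 : p ≠ 2) {A : Finset (ZMod p)} (hA : A.Nonempty)
    (h : #A * #(A - A) * #(sqDiff A) ≤ p ^ 2) {t : ℕ} (ht : 2 * p ^ 2 < 2 ^ t) :
    (#A : ℝ) ^ 53 ≤ 2 ^ 96 * (45000000 + t : ℝ) ^ 22 * #(A - A) ^ 27 * #(sqDiff A) ^ 17 := by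
  have hn0 : (0 : ℝ) < #A := by exact_mod_cast hA.card_pos
  have hS : (sqSet A).Nonempty := hA.image _
  have hsl : (#A : ℝ) ≤ 2 * #(sqSet A) := by exact_mod_cast card_le_two_mul_card_sqSet A
  have hlog : Nat.log 2 #(sqSet A) + 1 ≤ t := by
    have h1 : #(sqSet A) ≤ p := (card_le_univ _).trans_eq (ZMod.card p)
    have h2 : #(sqSet A) < 2 ^ t := by nlinarith [(Fact.out : p.Prime).two_le]
    exact Nat.log_lt_of_lt_pow hS.card_pos.ne' h2
  have hH : ∀ T : Finset (ZMod p), #T ≤ #(sqSet A - sqSet A) → (diffEnergy (sqSet A) T : ℝ) ≤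
      ((45000000 + t) * ((#A * #(A - A) : ℕ) * √(#A * #(A - A) : ℕ)) / #A ^ 2) *
        (#T * √(#T)) := by
    intro T hT
    have h1 := card_sq_mul_diffEnergy_sqSet_le hp2 hA (T := T)
      ((Nat.mul_le_mul_left _ hT).trans h) ht
    rw [Nat.cast_mul (#A * #(A - A)), Real.sqrt_mul (Nat.cast_nonneg _)] at h1
    rw [div_mul_eq_mul_div, le_div_iff₀ (by positivity)]
    linarith
  have key := card_pow_le_of_diffEnergy_le hS (by positivity) hH
  change (_ : ℝ) ≤ _ * (#(sqDiff A) : ℝ) ^ 17 at key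
  obtain ⟨n, hn⟩ : ∃ n : ℝ, n = #A := ⟨_, rfl⟩
  obtain ⟨s, hs⟩ : ∃ s : ℝ, s = #(sqSet A) := ⟨_, rfl⟩
  obtain ⟨d, hd⟩ : ∃ d : ℝ, d = #(A - A) := ⟨_, rfl⟩
  obtain ⟨M, hM⟩ : ∃ M : ℝ, M = #(sqDiff A) := ⟨_, rfl⟩
  obtain ⟨l, hl⟩ : ∃ l : ℝ, l = (Nat.log 2 #(sqSet A) + 1 : ℕ) := ⟨_, rfl⟩
  obtain ⟨B, hB⟩ : ∃ B : ℝ, B = 45000000 + t := ⟨_, rfl⟩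
  have hlB : l ≤ B := by
    have : l ≤ t := hl ▸ by exact_mod_cast hlog
    linarith
  have hl0 : 0 ≤ l := hl ▸ Nat.cast_nonneg _
  have hd0 : 0 ≤ d := hd ▸ Nat.cast_nonneg _
  have hM0 : 0 ≤ M := hM ▸ Nat.cast_nonneg _
  have hB0 : 0 ≤ B := hl0.trans hlB
  rw [Nat.cast_mul, ← hB, ← hn, ← hd, ← hs, ← hM, ← hl] at key
  rw [← hB, ← hn, ← hd, ← hM]
  rw [← hn] at hn0
  rw [← hn, ← hs] at hsl
  have hsq : (√(n * d)) ^ 18 = (n * d) ^ 9 := by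
    rw [show 18 = 2 * 9 by rfl, pow_mul, Real.sq_sqrt (mul_nonneg hn0.le hd0)]
  have h1 : n ^ 36 * s ^ 44 ≤ 2 ^ 52 * l ^ 4 * B ^ 18 * (n * d) ^ 27 * M ^ 17 := by
    refine (mul_le_mul_of_nonneg_left key (by positivity)).trans_eq ?_
    rw [div_pow, mul_pow B, mul_pow (n * d), hsq]
    field_simp
  have h2 : n ^ 44 ≤ 2 ^ 44 * s ^ 44 := by
    rw [← mul_pow]
    exact pow_le_pow_left₀ hn0.le hsl 44
  have h3 : l ^ 4 ≤ B ^ 4 := pow_le_pow_left₀ hl0 hlB 4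
  have h4 : n ^ 27 * n ^ 53 ≤ n ^ 27 * (2 ^ 96 * B ^ 22 * d ^ 27 * M ^ 17) := by
    calc n ^ 27 * n ^ 53 = n ^ 36 * n ^ 44 := by ring
      _ ≤ n ^ 36 * (2 ^ 44 * s ^ 44) := by gcongr
      _ = 2 ^ 44 * (n ^ 36 * s ^ 44) := by ring
      _ ≤ 2 ^ 44 * (2 ^ 52 * l ^ 4 * B ^ 18 * (n * d) ^ 27 * M ^ 17) := by gcongr
      _ ≤ 2 ^ 44 * (2 ^ 52 * B ^ 4 * B ^ 18 * (n * d) ^ 27 * M ^ 17) := by gcongr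
      _ = _ := by ring
  exact le_of_mul_le_mul_left h4 (by positivity)

end Conclusion

section Asymptotics

lemma exists_add_log_le_mul_rpow {η : ℝ} (hη : 0 < η) (C : ℝ) (hC : 0 ≤ C) :
    ∃ B : ℝ, 1 ≤ B ∧ ∀ p : ℕ, 0 < p →
      C + (Nat.log 2 (2 * p ^ 2) + 1 : ℕ) ≤ B * (p : ℝ) ^ η := by
  refine ⟨C + 2 + 4 / η, by linarith [div_nonneg zero_le_four hη.le], fun p hp => ?_⟩
  have hp1 : (1 : ℝ) ≤ p := by exact_mod_cast hp
  have h1 : (1 : ℝ) ≤ (p : ℝ) ^ η := Real.one_le_rpow hp1 hη.le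
  have h2 : Real.log p ≤ (p : ℝ) ^ η / η := Real.log_natCast_le_rpow_div p hη
  have h3 : (Nat.log 2 (2 * p ^ 2) : ℝ) * Real.log 2 ≤ Real.log 2 + 2 * Real.log p := by
    have h : ((2 ^ Nat.log 2 (2 * p ^ 2) : ℕ) : ℝ) ≤ ((2 * p ^ 2 : ℕ) : ℝ) :=
      Nat.cast_le.2 (Nat.pow_log_le_self 2 (by positivity))
    push_cast at h
    have h' := Real.log_le_log (by positivity) h
    rwa [Real.log_pow, Real.log_mul two_ne_zero (by positivity), Real.log_pow,
      Nat.cast_ofNat] at h'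
  have h4 : (1 / 2 : ℝ) ≤ Real.log 2 := by linarith [Real.log_two_gt_d9]
  have h5 : 0 ≤ Real.log p := Real.log_nonneg hp1
  have h6 : (Nat.log 2 (2 * p ^ 2) : ℝ) ≤ 1 + 4 * Real.log p := by
    by_contra! h
    nlinarith
  push_cast
  calc C + ((Nat.log 2 (2 * p ^ 2) : ℝ) + 1) ≤ (C + 2) * 1 + 4 * ((p : ℝ) ^ η / η) := by linarith
    _ ≤ (C + 2) * (p : ℝ) ^ η + 4 * ((p : ℝ) ^ η / η) := by gcongr
    _ = _ := by ring

lemma rpow_card_le_four (A : Finset (ZMod 2)) {e : ℝ} (he : 0 ≤ e) (he' : e ≤ 2) :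
    (#A : ℝ) ^ e ≤ 4 := by
  have h : (#A : ℝ) ≤ 2 := by exact_mod_cast card_le_univ A
  calc (#A : ℝ) ^ e ≤ (2 : ℝ) ^ e := Real.rpow_le_rpow (Nat.cast_nonneg _) h he
    _ ≤ (2 : ℝ) ^ (2 : ℝ) := Real.rpow_le_rpow_of_exponent_le one_le_two he'
    _ = 4 := by norm_num

end Asymptotics

/-- Let `0 < ε₀ < 1/54`. For every `δ > 0` there exists `c_δ > 0` such that for every
prime `p` and `A ⊆ 𝔽_p` with `|A|·|A-A|·|A²-A²| ≤ p²` and `|A-A| ≤ |A|^{1+ε₀}`, one has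
`|A²-A²| ≥ c_δ·p^{-δ}·|A|^{1 + (9-27ε₀)/17}`. -/
theorem sq_diff_lower_of_small_diff (ε₀ : ℝ) (hε₀ : 0 < ε₀) (hε₀' : ε₀ < 1 / 54)
    (δ : ℝ) (hδ : 0 < δ) :
    ∃ cδ : ℝ, 0 < cδ ∧
      ∀ (p : ℕ), p.Prime →
        ∀ A : Finset (ZMod p),
          A.card * (A - A).card * (sqDiff A).card ≤ p ^ 2 →
          ((A - A).card : ℝ) ≤ (A.card : ℝ) ^ ((1 : ℝ) + ε₀) →
          cδ * (p : ℝ) ^ (-δ) * (A.card : ℝ) ^ ((1 : ℝ) + (9 - 27 * ε₀) / 17) ≤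
            ((sqDiff A).card : ℝ) := by
  obtain ⟨B, hB1, hB⟩ := exists_add_log_le_mul_rpow (η := 17 * δ / 22) (by positivity)
    45000000 (by norm_num)
  have hB0 : 0 < B := one_pos.trans_le hB1
  obtain ⟨e, he⟩ : ∃ e : ℝ, e = 1 + (9 - 27 * ε₀) / 17 := ⟨_, rfl⟩
  refine ⟨(2 ^ 6 * B ^ 2)⁻¹, by positivity, fun p hp A h hd => ?_⟩
  have : Fact p.Prime := ⟨hp⟩
  rw [← he, Real.rpow_neg (Nat.cast_nonneg _)]
  obtain ⟨q, hq⟩ : ∃ q : ℝ, q = (p : ℝ) ^ δ := ⟨_, rfl⟩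
  have hp1 : (1 : ℝ) ≤ p := by exact_mod_cast hp.one_le
  have hq1 : 1 ≤ q := hq ▸ Real.one_le_rpow hp1 hδ.le
  rw [← hq, ← mul_inv, inv_mul_le_iff₀ (by positivity)]
  rcases A.eq_empty_or_nonempty with rfl | hA
  · rw [card_empty, Nat.cast_zero, Real.zero_rpow (by linarith)]
    positivity
  have hM1 : (1 : ℝ) ≤ #(sqDiff A) := by
    exact_mod_cast ((hA.image _).sub (hA.image _)).card_pos
  rcases eq_or_ne p 2 with rfl | hp2
  · have h1 := rpow_card_le_four A (e := e) (by linarith) (by linarith)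
    have h2 : (1 : ℝ) ≤ B ^ 2 * q * #(sqDiff A) :=
      one_le_mul_of_one_le_of_one_le
        (one_le_mul_of_one_le_of_one_le (one_le_pow₀ hB1) hq1) hM1
    linarith
  have key := card_pow_le_mul_card_sqDiff_pow hp2 hA h (Nat.lt_pow_succ_log_self one_lt_two _)
  have hn0 : (0 : ℝ) < #A := by exact_mod_cast hA.card_pos
  obtain ⟨w, hw⟩ : ∃ w : ℝ, w = (#A : ℝ) ^ ((1 + ε₀) * 27) := ⟨_, rfl⟩
  have hw0 : 0 < w := hw ▸ Real.rpow_pos_of_pos hn0 _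
  have hdw : (#(A - A) : ℝ) ^ 27 ≤ w := by
    rw [hw, Real.rpow_mul hn0.le]
    exact_mod_cast pow_le_pow_left₀ (Nat.cast_nonneg _) hd 27
  have hBq : (45000000 + (Nat.log 2 (2 * p ^ 2) + 1 : ℕ) : ℝ) ^ 22 ≤ B ^ 22 * q ^ 17 := by
    refine (pow_le_pow_left₀ (by positivity) (hB p hp.pos) 22).trans_eq ?_
    rw [mul_pow, hq, ← Real.rpow_mul_natCast (Nat.cast_nonneg _),
      ← Real.rpow_mul_natCast (Nat.cast_nonneg _)]
    congr 2
    push_cast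
    ring
  have hwn : w * ((#A : ℝ) ^ e) ^ 17 = (#A : ℝ) ^ 53 := by
    rw [hw, ← Real.rpow_mul_natCast hn0.le, ← Real.rpow_add hn0, ← Real.rpow_natCast]
    congr 1
    rw [he]
    push_cast
    ring
  have h1 : w * ((#A : ℝ) ^ e) ^ 17 ≤ w * (2 ^ 6 * B ^ 2 * q * #(sqDiff A)) ^ 17 := by
    calc w * ((#A : ℝ) ^ e) ^ 17 = (#A : ℝ) ^ 53 := hwn
      _ ≤ _ := key
      _ ≤ 2 ^ 96 * (B ^ 22 * q ^ 17) * w * #(sqDiff A) ^ 17 := by gcongr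
      _ ≤ 2 ^ 102 * (B ^ 34 * q ^ 17) * w * #(sqDiff A) ^ 17 := by
        gcongr <;> first | exact hB1 | norm_num
      _ = _ := by ring
  exact le_of_pow_le_pow_left₀ (by norm_num) (by positivity) (le_of_mul_le_mul_left h1 hw0)

end FpSumProd
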